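/- Let T̃₃ : [0,1) → [0,1) be the generalized Bolyai–Rényi map T̃₃(x) = (x+1)³ − 1 (mod 1), i.e. T̃₃(x) = (x+1)³ − 1 − ⌊(x+1)³ − 1⌋. For any T̃₃-invariant Borel probability measure μ₃ on [0,1) absolutely continuous with respect to Lebesgue measure, the metric entropy satisfies |∫ log(3(x+1)²) dμ₃(x) − 1.834954493847482| ≤ 10⁻¹⁵. -/

import Mathlib

open MeasureTheory Real Filter

/-- The generalized Bolyai–Rényi map `T̃₃(x) = (x+1)³ − 1 (mod 1)`. -/
noncomputable def T3 (x : ℝ) : ℝ := Int.fract ((x + 1) ^ 3 - 1)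

namespace BR

/-- real cube root -/
noncomputable def cr (x : ℝ) : ℝ := x ^ (1 / 3 : ℝ)

lemma cr_pow {x : ℝ} (hx : 0 ≤ x) : cr x ^ 3 = x := by
  unfold cr
  rw [← Real.rpow_natCast, ← Real.rpow_mul hx]
  norm_num

lemma cr_nonneg {x : ℝ} (hx : 0 ≤ x) : 0 ≤ cr x := Real.rpow_nonneg hx _

lemma cr_pos {x : ℝ} (hx : 0 < x) : 0 < cr x := Real.rpow_pos_of_pos hx _

lemma le_cr {r x : ℝ} (hx : 0 ≤ x) (h : r ^ 3 ≤ x) : r ≤ cr x := by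
  by_contra hlt
  push Not at hlt
  have h0 := cr_nonneg hx
  have : cr x ^ 3 < r ^ 3 := pow_lt_pow_left₀ hlt h0 (by norm_num)
  rw [cr_pow hx] at this
  linarith

lemma cr_le {r x : ℝ} (hr : 0 ≤ r) (hx : 0 ≤ x) (h : x ≤ r ^ 3) : cr x ≤ r := by
  by_contra hlt
  push Not at hlt
  have : r ^ 3 < cr x ^ 3 := pow_lt_pow_left₀ hlt hr (by norm_num)
  rw [cr_pow hx] at this
  linarith

lemma cr_hasDerivAt {x : ℝ} (hx : 0 < x) : HasDerivAt cr (1 / (3 * cr x ^ 2)) x := by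
  have h := Real.hasDerivAt_rpow_const (x := x) (p := (1 / 3 : ℝ)) (Or.inl hx.ne')
  have h2 : (1 / 3 : ℝ) * x ^ ((1 / 3 : ℝ) - 1) = 1 / (3 * cr x ^ 2) := by
    have h3 : x ^ ((1 / 3 : ℝ) - 1) * cr x ^ 2 = 1 := by
      unfold cr
      rw [← Real.rpow_natCast, ← Real.rpow_mul hx.le, ← Real.rpow_add hx]
      norm_num
    have := cr_pos hx
    field_simp
    linarith
  rw [h2] at h
  exact h

lemma cr_eq {r x : ℝ} (hr : 0 ≤ r) (h : r ^ 3 = x) : cr x = r := by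
  have hx : 0 ≤ x := by rw [← h]; positivity
  exact le_antisymm (cr_le hr hx h.ge) (le_cr hx h.le)

/-- inverse branches -/
noncomputable def br (i : ℕ) (x : ℝ) : ℝ := cr (x + i) - 1

/-- transfer operator -/
noncomputable def Lop (f : ℝ → ℝ) (x : ℝ) : ℝ :=
  ∑ i ∈ Finset.Icc (1 : ℕ) 7, f (br i x) / (3 * cr (x + i) ^ 2)

def IsLip (K : ℝ) (f : ℝ → ℝ) : Prop :=
  ∀ x ∈ Set.Icc (0 : ℝ) 1, ∀ y ∈ Set.Icc (0 : ℝ) 1, |f x - f y| ≤ K * |x - y|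

lemma br_mem {i : ℕ} (h1 : 1 ≤ i) (h7 : i ≤ 7) {x : ℝ} (hx : x ∈ Set.Icc (0 : ℝ) 1) :
    br i x ∈ Set.Icc (0 : ℝ) 1 := by
  have h1' : (1 : ℝ) ≤ i := by exact_mod_cast h1
  have h7' : (i : ℝ) ≤ 7 := by exact_mod_cast h7
  unfold br
  constructor
  · have := le_cr (r := 1) (x := x + i) (by linarith [hx.1]) (by linarith [hx.1])
    linarith
  · have := cr_le (r := 2) (x := x + i) (by norm_num) (by linarith [hx.1]) (by linarith [hx.2])
    linarith

lemma IsLip.continuousOn {K : ℝ} {f : ℝ → ℝ} (h : IsLip K f) :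
    ContinuousOn f (Set.Icc (0 : ℝ) 1) := by
  have : LipschitzOnWith (Real.toNNReal K) f (Set.Icc (0 : ℝ) 1) := by
    apply LipschitzOnWith.of_dist_le_mul
    intro x hx y hy
    rw [Real.dist_eq, Real.dist_eq]
    refine (h x hx y hy).trans ?_
    gcongr
    exact Real.le_coe_toNNReal K
  exact this.continuousOn

/-- Lebesgue measure on `[0,1)` -/
noncomputable def nu : Measure ℝ := volume.restrict (Set.Ico (0 : ℝ) 1)

instance : IsProbabilityMeasure nu := by
  constructor
  simp [nu]

lemma ae_nu : ∀ᵐ x ∂nu, x ∈ Set.Ico (0 : ℝ) 1 := ae_restrict_mem measurableSet_Ico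

lemma IsLip.integrable {K : ℝ} {f : ℝ → ℝ} (h : IsLip K f) : Integrable f nu := by
  have := (h.continuousOn.integrableOn_compact (μ := volume) isCompact_Icc)
  exact this.mono_set Set.Ico_subset_Icc_self

lemma abs_le_of_mean_zero {K : ℝ} {f : ℝ → ℝ} (hf : IsLip K f) (h0 : ∫ x, f x ∂nu = 0)
    (hK : 0 ≤ K) {x : ℝ} (hx : x ∈ Set.Icc (0 : ℝ) 1) : |f x| ≤ K := by
  have h1 : f x = ∫ t, (f x - f t) ∂nu := by
    rw [integral_sub (integrable_const _) hf.integrable, h0]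
    simp
  rw [h1, ← Real.norm_eq_abs]
  have := norm_integral_le_of_norm_le_const (μ := nu) (f := fun t => f x - f t) (C := K) ?_
  · simpa using this
  · filter_upwards [ae_nu] with t ht
    rw [Real.norm_eq_abs]
    refine (hf x hx t ⟨ht.1, ht.2.le⟩).trans ?_
    have : |x - t| ≤ 1 := by
      rw [abs_le]; constructor <;> linarith [hx.1, hx.2, ht.1, ht.2]
    nlinarith

/-- one branch estimate -/
lemma branch_lip {K : ℝ} {f : ℝ → ℝ} (hf : IsLip K f) (hK : 0 ≤ K)
    (hb : ∀ x ∈ Set.Icc (0 : ℝ) 1, |f x| ≤ K) {i : ℕ} (h1 : 1 ≤ i) (h7 : i ≤ 7)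
    {r : ℝ} (hr : 0 < r) (hri : r ^ 3 ≤ i) {x y : ℝ} (hx : x ∈ Set.Icc (0 : ℝ) 1)
    (hy : y ∈ Set.Icc (0 : ℝ) 1) :
    |f (br i x) / (3 * cr (x + i) ^ 2) - f (br i y) / (3 * cr (y + i) ^ 2)|
      ≤ (1 / 9 * (1 / r ^ 4 + 2 / r ^ 5)) * K * |x - y| := by
  have hx0 : 0 ≤ x + i := add_nonneg hx.1 (Nat.cast_nonneg _)
  have hy0 : 0 ≤ y + i := add_nonneg hy.1 (Nat.cast_nonneg _)
  have hxr : r ≤ cr (x + i) := le_cr hx0 (by linarith [hx.1])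
  have hyr : r ≤ cr (y + i) := le_cr hy0 (by linarith [hy.1])
  have hxc := cr_pow hx0
  have hyc := cr_pow hy0
  have hfl := hf _ (br_mem h1 h7 hx) _ (br_mem h1 h7 hy)
  have hfb := hb _ (br_mem h1 h7 hy)
  have hbr : br i x - br i y = cr (x + i) - cr (y + i) := by unfold br; ring
  rw [hbr] at hfl
  generalize cr (x + i) = a at *
  generalize cr (y + i) = b at *
  generalize f (br i x) = F at *
  generalize f (br i y) = G at *
  have ha : 0 < a := by linarith
  have hbp : 0 < b := by linarith
  have hd : x - y = (a - b) * (a ^ 2 + a * b + b ^ 2) := by nlinarith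
  have hdabs : |x - y| = |a - b| * (a ^ 2 + a * b + b ^ 2) := by
    rw [hd, abs_mul, abs_of_pos (a := a ^ 2 + a * b + b ^ 2) (by positivity)]
  have h3r : 3 * r ^ 2 ≤ a ^ 2 + a * b + b ^ 2 := by nlinarith
  have hab : |a - b| ≤ |x - y| / (3 * r ^ 2) := by
    rw [le_div_iff₀ (by positivity), hdabs]
    gcongr
  have hsplit : F / (3 * a ^ 2) - G / (3 * b ^ 2)
      = (F - G) * (1 / (3 * a ^ 2)) + G * ((b - a) * ((1 / a ^ 2) * (1 / b) + (1 / a) * (1 / b ^ 2)) / 3) := by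
    field_simp
    ring
  have e1 : 1 / (3 * a ^ 2) ≤ 1 / (3 * r ^ 2) := by gcongr
  have e2 : (1 / a ^ 2) * (1 / b) + (1 / a) * (1 / b ^ 2) ≤ 2 / r ^ 3 := by
    have : 2 / r ^ 3 = (1 / r ^ 2) * (1 / r) + (1 / r) * (1 / r ^ 2) := by field_simp; ring
    rw [this]
    gcongr
  have hba : |b - a| = |a - b| := abs_sub_comm _ _
  rw [hsplit]
  refine (abs_add_le _ _).trans ?_
  rw [abs_mul (F - G), abs_mul G, abs_div _ (3 : ℝ), abs_mul (b - a), hba, abs_of_pos (a := 1 / (3 * a ^ 2)) (by positivity),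
    abs_of_pos (a := (1 / a ^ 2) * (1 / b) + (1 / a) * (1 / b ^ 2)) (by positivity),
    abs_of_pos (a := (3 : ℝ)) (by norm_num)]
  have t1 : |F - G| * (1 / (3 * a ^ 2)) ≤ (K * (|x - y| / (3 * r ^ 2))) * (1 / (3 * r ^ 2)) := by
    gcongr
    exact hfl.trans (by gcongr)
  have t2 : |G| * (|a - b| * ((1 / a ^ 2) * (1 / b) + (1 / a) * (1 / b ^ 2)) / 3)
      ≤ K * (|x - y| / (3 * r ^ 2) * (2 / r ^ 3) / 3) := by
    gcongr
  refine (add_le_add t1 t2).trans (le_of_eq ?_)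
  field_simp
  ring

lemma Lop_lip {K : ℝ} {f : ℝ → ℝ} (hf : IsLip K f) (h0 : ∫ x, f x ∂nu = 0)
    (hK : 0 ≤ K) : IsLip (7 / 10 * K) (Lop f) := by
  intro x hx y hy
  have hb : ∀ x ∈ Set.Icc (0 : ℝ) 1, |f x| ≤ K := fun x hx => abs_le_of_mean_zero hf h0 hK hx
  unfold Lop
  rw [← Finset.sum_sub_distrib]
  refine (Finset.abs_sum_le_sum_abs _ _).trans ?_
  have key := fun (i : ℕ) (h1 : 1 ≤ i) (h7 : i ≤ 7) (r : ℝ) (hr : 0 < r) (hri : r ^ 3 ≤ i) =>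
    branch_lip hf hK hb h1 h7 hr hri hx hy
  have k1 := key 1 (by norm_num) (by norm_num) 1 (by norm_num) (by norm_num)
  have k2 := key 2 (by norm_num) (by norm_num) (5 / 4) (by norm_num) (by norm_num)
  have k3 := key 3 (by norm_num) (by norm_num) (7 / 5) (by norm_num) (by norm_num)
  have k4 := key 4 (by norm_num) (by norm_num) (3 / 2) (by norm_num) (by norm_num)
  have k5 := key 5 (by norm_num) (by norm_num) (17 / 10) (by norm_num) (by norm_num)
  have k6 := key 6 (by norm_num) (by norm_num) (9 / 5) (by norm_num) (by norm_num)
  have k7 := key 7 (by norm_num) (by norm_num) (19 / 10) (by norm_num) (by norm_num)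
  have hset : Finset.Icc 1 7 = ({1, 2, 3, 4, 5, 6, 7} : Finset ℕ) := by decide
  rw [hset]
  rw [Finset.sum_insert (by decide), Finset.sum_insert (by decide), Finset.sum_insert (by decide),
    Finset.sum_insert (by decide), Finset.sum_insert (by decide), Finset.sum_insert (by decide),
    Finset.sum_singleton]
  have hP : 0 ≤ K * |x - y| := by positivity
  norm_num only at k1 k2 k3 k4 k5 k6 k7 ⊢
  nlinarith

/-- pieces of the partition -/
lemma br_image {i : ℕ} (h1 : 1 ≤ i) (h7 : i ≤ 7) :
    br i '' Set.Ico (0 : ℝ) 1 = {y | 0 ≤ y ∧ (i : ℝ) ≤ (y + 1) ^ 3 ∧ (y + 1) ^ 3 < i + 1} := by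
  ext y
  constructor
  · rintro ⟨x, hx, rfl⟩
    have hx0 : 0 ≤ x + i := add_nonneg hx.1 (Nat.cast_nonneg _)
    refine ⟨(br_mem h1 h7 ⟨hx.1, hx.2.le⟩).1, ?_, ?_⟩
    · simp only [br, sub_add_cancel]; rw [cr_pow hx0]; linarith [hx.1]
    · simp only [br, sub_add_cancel]; rw [cr_pow hx0]; linarith [hx.2]
  · rintro ⟨h0, h2, h3⟩
    refine ⟨(y + 1) ^ 3 - i, ⟨by linarith, by linarith⟩, ?_⟩
    unfold br
    rw [cr_eq (r := y + 1) (by linarith) (by ring)]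
    ring

lemma union_image : (⋃ i ∈ Finset.Icc (1 : ℕ) 7, br i '' Set.Ico (0 : ℝ) 1) = Set.Ico (0 : ℝ) 1 := by
  ext y
  simp only [Set.mem_iUnion, exists_prop]
  constructor
  · rintro ⟨i, hi, hy⟩
    rw [Finset.mem_Icc] at hi
    rw [br_image hi.1 hi.2] at hy
    refine ⟨hy.1, ?_⟩
    have h7 : (i : ℝ) ≤ 7 := by exact_mod_cast hi.2
    by_contra hle
    push Not at hle
    have h3 := hy.2.2
    nlinarith [sq_nonneg (y - 1), sq_nonneg y]
  · intro hy
    have hy0 := hy.1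
    have hy1 := hy.2
    have hge : (1 : ℝ) ≤ (y + 1) ^ 3 := one_le_pow₀ (by linarith)
    have hlt : (y + 1) ^ 3 < 8 := by
      have : (y + 1) ^ 3 < 2 ^ 3 := pow_lt_pow_left₀ (by linarith) (by linarith) (by norm_num)
      linarith
    have hm : ⌊(y + 1) ^ 3⌋₊ ∈ Finset.Icc (1 : ℕ) 7 := by
      rw [Finset.mem_Icc]
      constructor
      · exact Nat.le_floor (by exact_mod_cast hge)
      · have := (Nat.floor_lt (by positivity)).2 (show (y + 1) ^ 3 < ((8 : ℕ) : ℝ) by exact_mod_cast hlt)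
        omega
    refine ⟨⌊(y + 1) ^ 3⌋₊, hm, ?_⟩
    rw [Finset.mem_Icc] at hm
    rw [br_image hm.1 hm.2]
    exact ⟨hy0, Nat.floor_le (by positivity), Nat.lt_floor_add_one _⟩

lemma T3_br {i : ℕ} {x : ℝ} (hx : x ∈ Set.Ico (0 : ℝ) 1) : T3 (br i x) = x := by
  have hx0 : 0 ≤ x + i := add_nonneg hx.1 (Nat.cast_nonneg _)
  unfold T3 br
  rw [sub_add_cancel, cr_pow hx0]
  have : x + (i : ℝ) - 1 = x + ((i - 1 : ℤ) : ℝ) := by push_cast; ring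
  rw [this, Int.fract_add_intCast, Int.fract_eq_self.2 hx]

lemma T3_measurable : Measurable T3 := by
  unfold T3
  fun_prop

lemma T3_mem (x : ℝ) : T3 x ∈ Set.Ico (0 : ℝ) 1 := ⟨Int.fract_nonneg _, Int.fract_lt_one _⟩

lemma integrable_mul {φ : ℝ → ℝ} (hφ : Measurable φ) {M : ℝ} (hM : ∀ x, |φ x| ≤ M)
    {f : ℝ → ℝ} (hf : Integrable f nu) : Integrable (fun x => φ x * f x) nu :=
  hf.bdd_mul (c := M) hφ.aestronglyMeasurable (Eventually.of_forall fun x => hM x)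

lemma duality {φ : ℝ → ℝ} (hφ : Measurable φ) {M : ℝ} (hM : ∀ x, |φ x| ≤ M)
    {f : ℝ → ℝ} {K : ℝ} (hf : IsLip K f) :
    ∫ x, φ (T3 x) * f x ∂nu = ∫ x, φ x * Lop f x ∂nu := by
  have hintg : Integrable (fun x => φ (T3 x) * f x) nu :=
    integrable_mul (φ := fun x => φ (T3 x)) (hφ.comp T3_measurable) (fun x => hM _) hf.integrable
  have hmeas : ∀ i ∈ Finset.Icc (1 : ℕ) 7, MeasurableSet (br i '' Set.Ico (0 : ℝ) 1) := by
    intro i hi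
    rw [Finset.mem_Icc] at hi
    rw [br_image hi.1 hi.2]
    measurability
  have hbi := fun i (hi : i ∈ Finset.Icc (1 : ℕ) 7) =>
    (Set.subset_biUnion_of_mem (u := fun i => br i '' Set.Ico (0 : ℝ) 1) hi)
  have hsub : ∀ i ∈ Finset.Icc (1 : ℕ) 7, br i '' Set.Ico (0 : ℝ) 1 ⊆ Set.Ico (0 : ℝ) 1 := by
    intro i hi y hy
    rw [← union_image]
    simp only [Set.mem_iUnion]
    exact ⟨i, hi, hy⟩
  have hder : ∀ i ∈ Finset.Icc (1 : ℕ) 7, ∀ x ∈ Set.Ico (0 : ℝ) 1,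
      HasDerivAt (br i) (1 / (3 * cr (x + i) ^ 2)) x := by
    intro i hi x hx
    rw [Finset.mem_Icc] at hi
    have h1' : (1 : ℝ) ≤ i := by exact_mod_cast hi.1
    have h := (cr_hasDerivAt (x := x + i) (by linarith [hx.1])).comp_add_const x i
    exact h.sub_const 1
  have hstep : ∀ i ∈ Finset.Icc (1 : ℕ) 7, ∀ g : ℝ → ℝ, ∫ x in br i '' Set.Ico (0 : ℝ) 1, g x
      = ∫ x in Set.Ico (0 : ℝ) 1, |1 / (3 * cr (x + i) ^ 2)| • g (br i x) := by
    intro i hi g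
    apply integral_image_eq_integral_abs_deriv_smul measurableSet_Ico
    · intro x hx
      exact (hder i hi x hx).hasDerivWithinAt
    · intro x hx y hy hxy
      rw [← T3_br (i := i) hx, hxy, T3_br hy]
  have hstep' : ∀ i ∈ Finset.Icc (1 : ℕ) 7, IntegrableOn (fun x => |1 / (3 * cr (x + i) ^ 2)| • (φ (T3 (br i x)) * f (br i x)))
      (Set.Ico (0 : ℝ) 1) := by
    intro i hi
    refine (integrableOn_image_iff_integrableOn_abs_deriv_smul measurableSet_Ico
      (fun x hx => (hder i hi x hx).hasDerivWithinAt) ?_ (fun x => φ (T3 x) * f x)).1 ?_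
    · intro x hx y hy hxy
      rw [← T3_br (i := i) hx, hxy, T3_br hy]
    · exact IntegrableOn.mono_set hintg (hsub i hi)
  have heq : ∀ i ∈ Finset.Icc (1 : ℕ) 7, ∀ x ∈ Set.Ico (0 : ℝ) 1,
      |1 / (3 * cr (x + i) ^ 2)| • (φ (T3 (br i x)) * f (br i x))
        = φ x * (f (br i x) / (3 * cr (x + i) ^ 2)) := by
    intro i hi x hx
    rw [T3_br hx, abs_of_nonneg (by positivity), smul_eq_mul]
    ring
  have hLint : ∀ i ∈ Finset.Icc (1 : ℕ) 7, IntegrableOn (fun x => φ x * (f (br i x) / (3 * cr (x + i) ^ 2)))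
      (Set.Ico (0 : ℝ) 1) := by
    intro i hi
    exact (hstep' i hi).congr_fun (fun x hx => heq i hi x hx) measurableSet_Ico
  unfold nu
  conv_lhs => rw [← union_image]
  rw [integral_biUnion_finset _ hmeas ?_ ?_]
  · unfold Lop
    simp only [Finset.mul_sum]
    rw [integral_finsetSum _ hLint]
    refine Finset.sum_congr rfl fun i hi => ?_
    rw [hstep i hi]
    exact setIntegral_congr_fun measurableSet_Ico (fun x hx => heq i hi x hx)
  · intro i hi j hj hij
    rw [Finset.mem_coe, Finset.mem_Icc] at hi hj
    simp only [Function.onFun]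
    rw [br_image hi.1 hi.2, br_image hj.1 hj.2, Set.disjoint_left]
    rintro y ⟨_, h2, h3⟩ ⟨_, h4, h5⟩
    apply hij
    have a1 : (i : ℝ) < j + 1 := by linarith
    have a2 : (j : ℝ) < i + 1 := by linarith
    have a1' : i < j + 1 := by exact_mod_cast a1
    have a2' : j < i + 1 := by exact_mod_cast a2
    omega
  · intro i hi
    exact IntegrableOn.mono_set hintg (hsub i hi)

lemma Lop_mean {f : ℝ → ℝ} {K : ℝ} (hf : IsLip K f) :
    ∫ x, Lop f x ∂nu = ∫ x, f x ∂nu := by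
  have := duality (φ := fun _ => 1) measurable_const (M := 1) (by simp) hf
  simpa using this.symm

lemma decay {f : ℝ → ℝ} {K M : ℝ} {φ : ℝ → ℝ} (hφ : Measurable φ) (hM : ∀ x, |φ x| ≤ M)
    (hK : 0 ≤ K) (hf : IsLip K f) (h0 : ∫ x, f x ∂nu = 0) (n : ℕ) :
    |∫ x, φ (T3^[n] x) * f x ∂nu| ≤ M * K * (7 / 10) ^ n := by
  have hM0 : 0 ≤ M := (abs_nonneg _).trans (hM 0)
  induction n generalizing f K with
  | zero =>
    have := norm_integral_le_of_norm_le_const (μ := nu) (f := fun x => φ x * f x) (C := M * K) ?_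
    · simpa using this
    · filter_upwards [ae_nu] with t ht
      rw [norm_mul]
      have h2 := abs_le_of_mean_zero hf h0 hK ⟨ht.1, ht.2.le⟩
      exact mul_le_mul (hM t) h2 (abs_nonneg _) hM0
  | succ n ih =>
    have hmeas : Measurable (fun x => φ (T3^[n] x)) := hφ.comp (T3_measurable.iterate n)
    have h := duality (φ := fun x => φ (T3^[n] x)) hmeas (fun x => hM _) hf
    simp only [Function.iterate_succ, Function.comp_apply]
    rw [h]
    have := ih (f := Lop f) (K := 7 / 10 * K) (by positivity) (Lop_lip hf h0 hK)
      (by rw [Lop_mean hf, h0])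
    refine this.trans (le_of_eq ?_)
    ring

end BR

namespace BR

lemma poly_isLip (p : Polynomial ℝ) : ∃ K, 0 ≤ K ∧ IsLip K (fun x => p.eval x) := by
  obtain ⟨C, hC⟩ := (isCompact_Icc (a := (0 : ℝ)) (b := 1)).exists_bound_of_continuousOn
    (f := fun x => p.derivative.eval x) (Polynomial.continuous _).continuousOn
  refine ⟨max C 0, le_max_right _ _, ?_⟩
  intro x hx y hy
  have := Convex.norm_image_sub_le_of_norm_hasDerivWithin_le (f := fun x => p.eval x)
    (f' := fun x => p.derivative.eval x) (s := Set.Icc (0 : ℝ) 1) (C := max C 0)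
    (fun x _ => (p.hasDerivAt x).hasDerivWithinAt) (fun x hx => (hC x hx).trans (le_max_left _ _))
    (convex_Icc _ _) hy hx
  simpa [Real.norm_eq_abs] using this

lemma IsLip.comb {K1 K2 : ℝ} {f g : ℝ → ℝ} (hf : IsLip K1 f) (hg : IsLip K2 g) (a b : ℝ) :
    IsLip (|a| * K1 + |b| * K2) (fun x => a * f x - b * g x) := by
  intro x hx y hy
  have e : a * f x - b * g x - (a * f y - b * g y) = a * (f x - f y) - b * (g x - g y) := by ring
  simp only [e]
  refine (abs_sub _ _).trans ?_
  rw [abs_mul, abs_mul]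
  have h1 := mul_le_mul_of_nonneg_left (hf x hx y hy) (abs_nonneg a)
  have h2 := mul_le_mul_of_nonneg_left (hg x hx y hy) (abs_nonneg b)
  linarith

lemma approx {h : ℝ → ℝ} (hh : Integrable h nu) {δ : ℝ} (hδ : 0 < δ) :
    ∃ f K, 0 ≤ K ∧ IsLip K f ∧ ∫ x, |h x - f x| ∂nu ≤ δ := by
  haveI : nu.WeaklyRegular := by unfold nu; infer_instance
  obtain ⟨g, hg, hgi⟩ := hh.exists_boundedContinuous_integral_sub_le (half_pos hδ)
  obtain ⟨p, hp⟩ := exists_polynomial_near_of_continuousOn 0 1 g g.continuous.continuousOn (δ / 2)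
    (half_pos hδ)
  obtain ⟨K, hK, hL⟩ := poly_isLip p
  refine ⟨_, K, hK, hL, ?_⟩
  have i1 : Integrable (fun x => |h x - g x|) nu := (hh.sub hgi).abs
  have i2 : Integrable (fun x => |g x - p.eval x|) nu := (hgi.sub hL.integrable).abs
  have h2 : ∫ x, |g x - p.eval x| ∂nu ≤ δ / 2 := by
    have := integral_mono_ae i2 (integrable_const (δ / 2)) ?_
    · simpa using this
    · filter_upwards [ae_nu] with x hx
      rw [abs_sub_comm]
      exact (hp x ⟨hx.1, hx.2.le⟩).le
  calc ∫ x, |h x - p.eval x| ∂nu ≤ ∫ x, (|h x - g x| + |g x - p.eval x|) ∂nu := by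
        apply integral_mono (hh.sub hL.integrable).abs (i1.add i2)
        intro x
        exact abs_sub_le _ _ _
    _ = ∫ x, |h x - g x| ∂nu + ∫ x, |g x - p.eval x| ∂nu := integral_add i1 i2
    _ ≤ δ / 2 + δ / 2 := add_le_add hg h2
    _ = δ := by ring

lemma stability (μ : Measure ℝ) [IsProbabilityMeasure μ]
    (hsupp : μ (Set.Ico (0 : ℝ) 1)ᶜ = 0)
    (hinv : ∀ A : Set ℝ, MeasurableSet A → μ (T3 ⁻¹' A) = μ A)
    (hac : μ ≪ volume) {φ : ℝ → ℝ} (hφ : Measurable φ) {M : ℝ} (hM : ∀ x, |φ x| ≤ M)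
    {g : ℝ → ℝ} {K ε : ℝ} (hK : 0 ≤ K) (hg : IsLip K g) (hε : 0 ≤ ε)
    (he : IsLip ε (fun x => Lop g x - g x)) :
    |(∫ x, g x ∂nu) * (∫ x, φ x ∂μ) - ∫ x, φ x * g x ∂nu| ≤ M * ε / (3 / 10) := by
  have hM0 : 0 ≤ M := (abs_nonneg _).trans (hM 0)
  have hacn : μ ≪ nu := by
    intro s hs
    unfold nu at hs
    rw [Measure.restrict_apply' measurableSet_Ico] at hs
    have h1 := hac hs
    have : s ⊆ (s ∩ Set.Ico (0 : ℝ) 1) ∪ (Set.Ico (0 : ℝ) 1)ᶜ := by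
      intro x hx
      by_cases h : x ∈ Set.Ico (0 : ℝ) 1
      · exact Or.inl ⟨hx, h⟩
      · exact Or.inr h
    exact measure_mono_null this (measure_union_null h1 hsupp)
  have hmp : MeasurePreserving T3 μ μ := by
    refine ⟨T3_measurable, ?_⟩
    ext A hA
    rw [Measure.map_apply T3_measurable hA, hinv A hA]
  set I := ∫ x, φ x ∂μ with hI
  set c0 := ∫ x, g x ∂nu with hc0
  set J := fun n : ℕ => ∫ x, φ (T3^[n] x) * g x ∂nu with hJ
  have hφn : ∀ n : ℕ, Measurable (fun x => φ (T3^[n] x)) :=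
    fun n => hφ.comp (T3_measurable.iterate n)
  have hIn : ∀ n : ℕ, ∫ x, φ (T3^[n] x) ∂μ = I := by
    intro n
    have h := (hmp.iterate n)
    rw [hI]
    conv_rhs => rw [← h.map_eq]
    rw [integral_map h.measurable.aemeasurable hφ.aestronglyMeasurable]
  -- e has mean zero
  have hLint : Integrable (Lop g) nu := by
    have := he.integrable.add hg.integrable
    refine this.congr (Eventually.of_forall fun x => ?_)
    simp
  have he0 : ∫ x, (Lop g x - g x) ∂nu = 0 := by
    rw [integral_sub hLint hg.integrable, Lop_mean hg, sub_self]
  have hstep : ∀ n, |J (n + 1) - J n| ≤ M * ε * (7 / 10) ^ n := by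
    intro n
    have h1 : J (n + 1) = ∫ x, φ (T3^[n] x) * Lop g x ∂nu := by
      have := duality (φ := fun x => φ (T3^[n] x)) (hφn n) (fun x => hM _) hg
      simp only [hJ, Function.iterate_succ, Function.comp_apply]
      exact this
    have h2 : J (n + 1) - J n = ∫ x, φ (T3^[n] x) * (Lop g x - g x) ∂nu := by
      rw [h1]
      simp only [hJ]
      rw [← integral_sub (integrable_mul (hφn n) (fun x => hM _) hLint)
        (integrable_mul (hφn n) (fun x => hM _) hg.integrable)]
      congr 1
      ext x
      ring
    rw [h2]
    exact decay hφ hM hε he he0 n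
  have hJn : ∀ n, |J n - J 0| ≤ M * ε / (3 / 10) * (1 - (7 / 10) ^ n) := by
    intro n
    induction n with
    | zero => simp
    | succ n ih =>
      have := abs_sub_le (J (n + 1)) (J n) (J 0)
      have h3 := hstep n
      have : M * ε / (3 / 10) * (1 - (7 / 10) ^ (n + 1))
        = M * ε / (3 / 10) * (1 - (7 / 10) ^ n) + M * ε * (7 / 10) ^ n := by
        rw [pow_succ]; ring
      linarith
  have hJn' : ∀ n, |J n - J 0| ≤ M * ε / (3 / 10) := by
    intro n
    refine (hJn n).trans ?_
    have : (0 : ℝ) ≤ (7 / 10) ^ n := by positivity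
    have : 0 ≤ M * ε / (3 / 10) := by positivity
    nlinarith
  have hJ0 : J 0 = ∫ x, φ x * g x ∂nu := by simp [hJ]
  have hJb : ∀ n, |J n| ≤ |J 0| + M * ε / (3 / 10) := by
    intro n
    have := abs_sub_abs_le_abs_sub (J n) (J 0)
    linarith [hJn' n]
  set h := fun x => (μ.rnDeriv nu x).toReal with hh
  have hhi : Integrable h nu := Measure.integrable_toReal_rnDeriv
  have hh1 : ∫ x, h x ∂nu = 1 := by
    have := integral_rnDeriv_smul (f := fun _ => (1 : ℝ)) hacn
    simpa using this
  have hIh : ∀ n : ℕ, I = ∫ x, φ (T3^[n] x) * h x ∂nu := by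
    intro n
    rw [← hIn n, ← integral_rnDeriv_smul hacn]
    congr 1
    ext x
    simp [hh, mul_comm]
  rw [← hJ0]
  set B := |J 0| + M * ε / (3 / 10) with hB
  -- for each δ
  have key : ∀ δ > 0, |c0 * I - J 0| ≤ M * ε / (3 / 10) + (|c0| * M + B) * δ := by
    intro δ hδ
    obtain ⟨f, Kf, hKf, hf, hfδ⟩ := approx hhi hδ
    set c1 := ∫ x, f x ∂nu with hc1
    have hc1' : |1 - c1| ≤ δ := by
      rw [← hh1, hc1, ← integral_sub hhi hf.integrable]
      exact (abs_integral_le_integral_abs).trans hfδ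
    have hG := hf.comb hg c0 c1
    have hG0 : ∫ x, (c0 * f x - c1 * g x) ∂nu = 0 := by
      rw [integral_sub (hf.integrable.const_mul _) (hg.integrable.const_mul _),
        integral_const_mul, integral_const_mul, ← hc0, ← hc1]
      ring
    have hn : ∀ n : ℕ, |c0 * I - J 0| ≤ M * ε / (3 / 10) + (|c0| * M + B) * δ
        + M * (|c0| * Kf + |c1| * K) * (7 / 10) ^ n := by
      intro n
      have hd := decay hφ hM (by positivity) hG hG0 n
      have e1 : ∫ x, φ (T3^[n] x) * (c0 * f x - c1 * g x) ∂nu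
          = c0 * (∫ x, φ (T3^[n] x) * f x ∂nu) - c1 * J n := by
        simp only [hJ]
        rw [← integral_const_mul, ← integral_const_mul, ← integral_sub]
        · congr 1
          ext x
          ring
        · exact (integrable_mul (hφn n) (fun x => hM _) hf.integrable).const_mul _
        · exact (integrable_mul (hφn n) (fun x => hM _) hg.integrable).const_mul _
      rw [e1] at hd
      have e2 : |I - ∫ x, φ (T3^[n] x) * f x ∂nu| ≤ M * δ := by
        rw [hIh n, ← integral_sub (integrable_mul (hφn n) (fun x => hM _) hhi)
          (integrable_mul (hφn n) (fun x => hM _) hf.integrable)]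
        refine (abs_integral_le_integral_abs).trans ?_
        calc _ ≤ ∫ x, M * |h x - f x| ∂nu := by
              apply integral_mono
              · exact ((integrable_mul (hφn n) (fun x => hM _) hhi).sub
                  (integrable_mul (hφn n) (fun x => hM _) hf.integrable)).abs
              · exact ((hhi.sub hf.integrable).abs).const_mul _
              · intro x
                simp only
                rw [← mul_sub, abs_mul]
                exact mul_le_mul_of_nonneg_right (hM _) (abs_nonneg _)
          _ = M * ∫ x, |h x - f x| ∂nu := integral_const_mul _ _
          _ ≤ M * δ := by gcongr
      set F := ∫ x, φ (T3^[n] x) * f x ∂nu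
      have e3 : c0 * I - J 0 = c0 * (I - F) + (c0 * F - c1 * J n) + (-(1 - c1) * J n) + (J n - J 0) := by
        ring
      rw [e3]
      have a1 := abs_add_le (c0 * (I - F) + (c0 * F - c1 * J n) + (-(1 - c1) * J n)) (J n - J 0)
      have a2 := abs_add_le (c0 * (I - F) + (c0 * F - c1 * J n)) (-(1 - c1) * J n)
      have a3 := abs_add_le (c0 * (I - F)) (c0 * F - c1 * J n)
      have b1 : |c0 * (I - F)| ≤ |c0| * (M * δ) := by rw [abs_mul]; gcongr
      have b2 : |-(1 - c1) * J n| ≤ δ * B := by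
        rw [abs_mul, abs_neg]
        exact mul_le_mul hc1' (hJb n) (abs_nonneg _) hδ.le
      have b3 := hJn' n
      linarith
    have hlim : Tendsto (fun n : ℕ => M * ε / (3 / 10) + (|c0| * M + B) * δ
        + M * (|c0| * Kf + |c1| * K) * (7 / 10 : ℝ) ^ n) atTop
        (nhds (M * ε / (3 / 10) + (|c0| * M + B) * δ + M * (|c0| * Kf + |c1| * K) * 0)) :=
      ((tendsto_pow_atTop_nhds_zero_of_lt_one (by norm_num) (by norm_num)).const_mul _).const_add _
    have := ge_of_tendsto' hlim hn
    simpa using this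
  have hBn : 0 ≤ |c0| * M + B := by positivity
  apply le_of_forall_pos_le_add
  intro η hη
  have := key (η / (|c0| * M + B + 1)) (by positivity)
  refine this.trans ?_
  have h2 : (|c0| * M + B) * (η / (|c0| * M + B + 1)) ≤ η := by
    rw [mul_div_assoc', div_le_iff₀ (by positivity)]
    nlinarith
  linarith

end BR

namespace BR

def Q0 : List ℤ :=
  [1026814024923158105372014003790733811481735239277577802,
    -285024381710088373484249178419368637766559101915852309601,
    4555205431011417597708104982171250750355225328183677925272,
    -15883932345487158703069112525966026795046205127060080734034,
    17932077987503872295043740476664092068610956299233215047689,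
    -7928040509657156242727785667031380624782632958362118888924,
    1525320553374429070194684004452855595019751926877579831788,
    -135508001905413106463405750377491326026441133549210041579,
    5720986285334171609510504347939782275973900209095591320,
    -115306127366246861946197692527903834766191631447304034,
    1088914324884654596153067647286962850859949096364104,
    -4603373278042845837576710905185650972831518858770,
    8017076772550373412629919314607293515652193549, -4974669058060688350490173480444922114371300,
    838365882202146995213657672682179069634, -20504090370517818828206322265116731]

def Q1 : List ℤ :=
  [-11575980741322466302460098657013639416697191785881387464,
    886915220576058116691245899032163920941673529402596181117,
    -7969067987116277774526079529544972744586932508919374022772,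
    18526269727810255525562318309739695399327418221650056576761,
    -15063333448182261548326686707064609150132621197669948902481,
    5001710965214055869906023392621325492693428124182090956930,
    -740170997317435731856695376751860591990411857702325555306,
    51215164385759106279022640988198051773348542084606703361,
    -1690955808985387415364993014639088212247763737779517859,
    26557781575822348791236535437069271011580365045683345,
    -193131673599468221298581688007911082606046010989045,
    614590985899466353358381888429587178553178833607,
    -774442664571132827147977750297310161957965199, 323866928901587933341564076742480256995430,
    -31782835511731920530267761411680679112, 291051496634746336452494270932726]

def Q2 : List ℤ :=
  [69399824182519962370097782183292908015413494043429500333,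
    -2208521941148083154861874488252579001007828365249700433671,
    12031512612111212916447232998001773944161080831162624441510,
    -19247731007846675338251766356493554671688739627929213606922,
    11460947515248499010058269203965007895552215077443876980912,
    -2885409951575169475112560759358957825966811900293762279103,
    330153484892644067783770140101685191641232321605370912088,
    -17832411504723930173800446827802907309972284759248264745,
    460282241470970089932818875561424741054824490220238139,
    -5616656242918199525100064917882660145616371970450232,
    31259361906245033325759499738314227941340414228124,
    -74070631531972077054677028054985955748871543885, 66261986493145006368727842409211855031970684,
    -18009105857972868399320138118406876803336, 942466685618613216702389874800931821,
    -2022612835499811917100227445807]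

def p1 : List ℤ :=
  [797749395259713586795778040503231216628006, 88638821695523731866197560055914579625334,
    -9848757966169303540688617783990508847259, 1823844067809130285312706997035279416159,
    -405298681735362285625045999341173203591, 99073011090866336486122355394509005322,
    -25685595468002383533439129176354186565, 6931033697714928889975638031714621772,
    -1925287138254146913882121675476283825, 546686471356115790361590105382154666,
    -157931647280655672771126030443733570, 46262805769080954650127827099679531,
    -13707498005653616192630467288793935, 4100533591434842450786891923998186,
    -1236668860908920739126205500888342, 375580913313079631882773522492015,
    -114760834623440998630847465205893, 35253328283017823108822423952137,
    -10880656877474636761982229614857, 3372367336293308470088059471272,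
    -1049180949069029301805174057729, 327522095212025020140239520667,
    -102557423753260359841893183239, 32204021951506876278855347394, -10138303206955868458158164920,
    3199197900861629602352132042, -1011712156682737566555802440, 320583687508521780348957975,
    -101772599209054533444113643, 32364466415139947417093611, -10308681895192723992111298,
    3288432575885851022573138, -1050471517296869076655308, 336009407889570916775267,
    -107610856121496568117569, 34503798311971915491665, -11075293285324318552880,
    3558727872461567823298, -1144620075937931171236, 368495921883151630626, -118737574829015525424,
    38292063427243489229, -12358814122020385412, 3991865026492372549, -1290299806542989107,
    417356233721312526, -135086317194820962, 43751360415343905, -14178681616083673,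
    4597622383446633, -1491673039962685, 484225017329935, -157269663748184, 51104398073309,
    -16614187027948, 5403806285858, -1758381410478, 572416560526, -186419186378, 60735441136,
    -19795254889, 6454190574, -2105130259, 686859079, -224183172, 73194848, -23905388, 7809886,
    -2552250, 834311, -272806, 89228, -29192, 9553, -3127, 1024, -335]

def p2 : List ℤ :=
  [945836494220090634987471304335597047220642, 63055766281339375665831420289039803148043,
    -4203717752089291711055428019269320209870, 467079750232143523450603113252146689986,
    -62277300030952469793413748433619558665, 9134004004539695569700683103597535271,
    -1420845067372841533064550705004061042, 230041582336555295829498685572086073,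
    -38340263722759215971583114262014346, 6532044930544162721084530577972814,
    -1132221121294321538321318633515288, 198996439500214088553443881042081,
    -35377144800038060187278912185259, 6349743938468369777203907315303,
    -1149001284103800245398802276102, 209373567325581378050448414756,
    -38385154009689919309248876039, 7074910739040887088371361466, -1310168655377942053402103975,
    243645399070283960808110564, -45480474493119672684180639, 8518565063790668851957643,
    -1600457678651580208549618, 301535504673486126248479, -56956706438325157180268,
    10783803085656229759464, -2046157508560412826155, 389022538664572315096, -74099531174204250494,
    14138531235537822508, -2702030413902783857, 517162810402898416, -99122871993888863,
    19023581493776650, -3655511738019827, 703250829600005, -135440900515556, 26112029468765,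
    -5039163581691, 973376896976, -188186200082, 36413264731, -7051457615, 1366561553, -265030119,
    51435475, -9988918, 1941109, -377438, 73433, -14295, 2784, -543, 106, -21, 4, -1]

def p3 : List ℤ :=
  [1058096827101050349419555966490625836615394, 50385563195288111877121712690029801743590,
    -2399312533108957708434367270953800083028, 190421629611822040351933910393158736748,
    -18135393296364003843041324799348451119, 1899898345333371831175757836122218689,
    -211099816148152425686195315124690965, 24412903908289736303845716715100316,
    -2906298084320206702838775799416704, 353676486451665365953925097283514,
    -43788517370206188165724059663673, 5497259756432811501324665498903,
    -698064730975595111279322603035, 89495478330204501446067000389, -11567442777373370935205938826,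
    1505603663086692724899820609, -197162384451828809213071746, 25956952574890627543457625,
    -3433459335302993061303919, 456073545792126897867438, -60809806105616919715658,
    8135552290774145721596, -1091784073653673235366, 146927463328134079294, -19823546639510153555,
    2680898688390896957, -363345243481550137, 49343181213543846, -6713357988237258,
    914956835835291, -124898869653706, 17075267894286, -2337685485527, 320461935245, -43984971504,
    6044193363, -831476336, 114501889, -15783468, 2177695, -300729, 41564, -5749, 796, -110, 15,
    -2, 0, 0]

def p4 : List ℤ :=
  [1150553722526316809974222348148722739171498, 42613100834308029999045272153656397747093,
    -1578262993863260370335010079765051768411, 97423641596497553724383338257101961013,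
    -7216566044185003979583950982007552668, 588016492489148472410544154089504291,
    -50816240091654806257701346649710247, 4570772918296993155454618481719969,
    -423219714657128995875427637196293, 40057833074543073683682451257262,
    -3857420962733777465836087898847, 376650531714745947842580973288,
    -37200052515036636823958614646, 3709406945943824184725217985, -372903343772130473596715035,
    37750708875697159055469917, -3844979607709895829723788, 393712508850468636159081,
    -40505402145109941991675, 4184768642672177242805, -433976007388225788143, 45157997241455593475,
    -4713460991532402013, 493357430675694253, -51772076058560508, 5445655407641179,
    -574043447529127, 60632846995532, -6416174285241, 680130862931, -72211424953, 7678395246,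
    -817606901, 87174698, -9306231, 994634, -106422, 11399, -1222, 131, -14, 2, 0, 0]

def p5 : List ℤ :=
  [1230146854502551215388647002755285070577445, 37277177409168218648140818265311668805377,
    -1129611436641461171155782371676111175921, 57051082658659655108877897559399554339,
    -3457641373252100309628963488448457839, 230509424883473353975264232563230523,
    -16298646203881954321483329575177916, 1199467469549754214135136808562877,
    -90868747693163198040540667315369, 7036973727079978299435809253379,
    -554428233042664956925245577539, 44293164623243205925157360189, -3579245626120663105063221025,
    292013046420100719527302415, -24018389099488803770643922, 1989401925412203948679598,
    -165783493784350329056633, 13889169710988351988702, -1169122029544474073123,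
    98825307122579148127, -8385177574037018629, 713889577010366665, -60965776549094674,
    5221048057564103, -448271802922170, 38578543039363, -3327286928803, 287543314835, -24895525094,
    2159173023, -187564525, 16317930, -1421638, 124018, -10832, 947, -83, 7, -1, 0, 0]

def p6 : List ℤ :=
  [1300590316544597351776976655368483439168539, 33348469654989675686589145009448293312014,
    -855088965512555786835619102806366495180, 36542263483442554992975175333605405777,
    -1873962229920131025280778222236174655, 105710689892930468092761848433835493,
    -6324571190175327150848999478947423, 393837766421174218184736231289766,
    -25246010668023988345175399441652, 1654296995340603224897533296746,
    -110286466356040214993168886450, 7455262294464256957580181135, -509761524407812441543944009,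
    35190637779632022591791007, -2449165266714316590637469, 171650899034678598660062,
    -12103589034496567854235, 858022148750133769456, -61112688657416935146, 4371082994390145159,
    -313821343186984781, 22607398349245546, -1633634845749678, 118379336648527, -8600208218055,
    626271572802, -45704237068, 3342095208, -244842140, 17968079, -1320731, 97225, -7167, 529, -39,
    3, 0, 0, 0]

def p7 : List ℤ :=
  [1364132277369991270300675110335335959060716, 30314050608222028228903891340785243534683,
    -673645569071600627308975363128560967437, 24949835891540763974406494930687443238,
    -1108881595179589509973621996919441922, 54211989097668820487599297627172716,
    -2810992027286531432690333951038585, 151704331631336617002335483071924,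
    -8428018423963145389018637948440, 478628206792968750487478204479,
    -27654074170260416694832074037, 1620137678661721382121475045, -96008158735509415236828151,
    5744077873064665868870060, -346468189168979846058829, 21044734453226923982833,
    -1286067105474978687840, 79013273146828755985, -4877362539927700987, 302339432299611874,
    -18812231343086961, 1174520263748286, -73555814497367, 4619447287274, -290854088458,
    18356124694, -1160985664, 73576869, -4671547, 297118, -18927, 1208, -77, 5, 0, 0, 0]

def DD : ℕ := 2 ^ 170

def EE : ℕ := 2 ^ 138

def GG : List ℤ :=
  [0, 0, 0,
    3287200265010053079238173515852080951119582635307601328667635385617409427011960218774870096640000,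
    -27794152132471716831197326891300234744982048513531972403183642020259459932842930370605327791360000,
    133304248816529144508384704132776103080186000730685752854197870029327955192427593890951007543936000,
    -456232677169482854402377544879104636787893866034766268684689462278210327539475755930422790836160000,
    1216857418336398519560567574348411865192586895975095919396414134652471228909947766315774703781760000,
    -2651351803007531787204624579416847288521221752276037113774449008497849170735652071933366686265520000,
    4860949219802011251770060593569648408348646186939614570780374809625341193892004296917530001095680000,
    -7653554128584912119142210025502401517212596557594842074309422467817810700299040041269849876346112000,
    10504688329062804184276582806193157998823484310212515892781679195248337715503621447130492694713600000,
    -12712542229688225527300065808606176163399395960522170280994064733169161106632004591569082560822720000,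
    13686747539341342799229111358317217577265600894349450819547045556624031776253163121355852237653120000,
    -13204049112963216472090963199282493104616593164959727082212452187553204078550279116421457652446080000,
    11481403658683943735247918507095400159297382525171584458752481793452709801759972824149182025332096000,
    -9041838243268739204540593983806580804188736955546122252441686673039289295445006914979703571136360000,
    6474812975741189764123078485356175835818804324085941599464419313017199300335052188525092040898560000,
    -4230083902211621078538853151351883443905715331483296938873555918971878858616915641525399727809280000,
    2528253496730091307573889821002268809553210527848159900783902623837323292863837687891925082771200000,
    -1385584944390053691006121945855672573852826368987637654656949491130787140975600874960779585566944000,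
    697585514246072331802148811158366007830003599405960374044995379034511058759354865751647662138880000,
    -323120869657089997812290258534137703448302238160526429857185557242797513109377151415736989086080000,
    137861714681336480028303879169940155280772238805901693070587677116405382217473006162295594869760000,
    -54226219276634771399253158097401089501954302941655510749609740088896707472341282741693229838160000,
    19674974963922950246093425605701638436178406291889441819155025471887451590036427636186347641062400,
    -6587071166205311122244755744733723423257965802544519011008366912856902667125754680239813275200000,
    2034992291885759289505226608676119679560465841526234036458017436360993468645248953209957913600000,
    -580002482905421954778493225643017748266859034699372027279059362996807402583698392318514190880000,
    152434000512110281911386475365927210266311529732638233384878244609763278085034741323409407360000,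
    -36913630242241261861818324919036112563671706471952220868167253728231538959979290384954569088000,
    8227837901144270401921071856491040232793173024410723560861991095134512906288379128056355200000,
    -1685712441778292399330210357283594936357738285900289205300479330364713405562376901247556960000,
    316909601442538898733750769839215921389257269637695790904342628528002984827395476820628480000,
    -54554453922099457253133182341350739927773393546780357743565192504805637335639942026484800000,
    8577637534142305907860210709136668410988533794000220993732762338928963152265425496748544000,
    -1228087518952540477138083888747851264743031859400947896626476892141563997798372203067200000,
    159529163603188319237556974993967846772007391806256380812292845298776525588572305266560000,
    -18720527283377327893074716002774795263309541939540937823636787455397387654309483819200000,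
    1974272342310756754517844869007092788123567489841082109758241560177671411274311487360000,
    -185945171454282911492396939715646538713653982852986025878031057581658702034413969776000,
    15521590483040134230420846829910616147281299238822254115866567446397994160872855040000,
    -1137550092468801177422262315675805822262919221580922771072944621776181706141344000000,
    72335880718095140422802929462523313950927675664049379986469698350551024564409600000,
    -3930928101522973526387489162068203627750401268319438408234949370815359699818240000,
    178927341158104476501782631368908238535813563269278182351047040058853484712192000,
    -6635756400552625658909503378151890649945123685687765580601791254459787077120000,
    192585584407638883698217626827703691064477962445806625030264719267692305280000,
    -4102559571632277001757800235308120575606531998557387192386927933788622120000,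
    57046549752501792923058183359829962181527086590270759763682117428535040000,
    -388506581765784295286629484194981159593416232338540179130662502451494400]

def SS : List ℤ :=
  [0, 0, 0,
    1095733421670017693079391171950693650373194211769200442889211795205803142337320072924956698880000,
    -6948538033117929207799331722825058686245512128382993100795910505064864983210732592651331947840000,
    26660849763305828901676940826555220616037200146137150570839574005865591038485518778190201508787200,
    -76038779528247142400396257479850772797982311005794378114114910379701721256579292655070465139360000,
    173836774048056931365795367764058837884655270853585131342344876378924461272849680902253529111680000,
    -331418975375941473400578072427105911065152719034504639221806126062231146341956508991670835783190000,
    540105468866890139085562288174405378705405131882179396753374978847260132654667144101947777899520000,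
    -765355412858491211914221002550240151721259655759484207430942246781781070029904004126984987634611200,
    954971666278436744025143891472105272620316755473865081161970835931667065045783767920953881337600000,
    -1059378519140685460608338817383848013616616330043514190082838727764096758886000382630756880068560000,
    1052826733795487907633008566024401352097353914949957755349772735124925521250243317027373249050240000,
    -943146365211658319435068799948749507472613797497123363015175156253800291325019936887246975174720000,
    765426910578929582349861233806360010619825501678105630583498786230180653450664854943278801688806400,
    -565114890204296200283787123987911300261796059721632640777605417064955580965312932186231473196022500,
    380871351514187633183710499138598578577576724946231858792024665471599958843238364030887767111680000,
    -235004661233978948807714063963993524661428629526849829937419773276215492145384202306966651544960000,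
    133065973512110068819678411631698358397537396202534731620205401254595962782307246731153951724800000,
    -69279247219502684550306097292783628692641318449381882732847474556539357048780043748038979278347200,
    33218357821241539609626133864684095610952552352664779716428351382595764702826422178649888673280000,
    -14687312257140454446013193569733531974922829007296655902599343511036250595880779609806226776640000,
    5993987594840716522969733876953919794816184295908769263938594657235016618151000267925895429120000,
    -2259425803193115474968881587391712062581429289235646281233739170370696144680886780903884576590000,
    786998998556918009843737024228065537447136251675577672766201018875498063601457105447453905642496,
    -253348891007896581624798297874373977817614069328635346577244881263727025658682872316915895200000,
    75370084884657751463156541062078506650387623760230890239185830976333091431305516785553996800000,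
    -20714374389479355527803329487250633866673536953549000974252120107028835806560656868518363960000,
    5256344845245182134875395702273352078148673439056490806375111883095285451208094528393427840000,
    -1230454341408042062060610830634537085455723549065074028938908457607717965332643012831818969600,
    265414125843363561352292640531969039767521710464862050350386809520468158267367068646979200000,
    -52678513805571637479069073665112341761179321434384037665639979073897293923824278163986155000,
    9603321255834512082840932419370179436038099079930175481949776622060696509921075055170560000,
    -1604542762414689919209799480627962939052158633728834051281329191317812862812939471367200000,
    245075358118351597367434591689619097456815251257149171249507495397970375779012157049958400,
    -34113542193126124364946774687440312909528662761137441572957691448376777716621450085200000,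
    4311599016302387006420458783620752615459659238006929211143049872939906096988440682880000,
    -492645454825719155080913579020389349034461629987919416411494406720983885639723258400000,
    50622367751557865500457560743771609951886345893361079737390809235324907981392602240000,
    -4648629286357072787309923492891163467841349571324650646950776439541467550860349244400,
    378575377635125225132215776339283320665397542410298880874794327960926686850557440000,
    -27084526011161932795768150373233471958640933847164827882689157661337659670032000000,
    1682229784141747451693091382849379394207620364280218139220225543036070338707200000,
    -89339275034613034690624753683368264267054574279987236550794303882167265904960000,
    3976163136846766144484058474864627523018079183761737385578823112418966326937600,
    -144255573925057079541510943003301970650980949688864469143517201183908414720000,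
    4097565625694444334004630358036248746052722605229928192133291899312602240000,
    -85469991075672437536620838235585845325136083303278899841394331953929627500,
    1164215301071465161695064966527142085337287481434097138034328927112960000,
    -7770131635315685905732589683899623191868324646770803582613250049029888]

def MM : ℕ := 9604076839297315498002557630759647800960000

end BR

namespace BR

def padd : List ℤ → List ℤ → List ℤ
  | [], b => b
  | a :: l, [] => a :: l
  | a :: l, b :: m => (a + b) :: padd l m

def psmul (c : ℤ) : List ℤ → List ℤ
  | [] => []
  | a :: l => (c * a) :: psmul c l

def pmul : List ℤ → List ℤ → List ℤ
  | [], _ => []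
  | a :: l, b => padd (psmul a b) (0 :: pmul l b)

def pcomp : List ℤ → List ℤ → List ℤ
  | [], _ => []
  | a :: l, q => padd [a] (pmul q (pcomp l q))

def pd : List ℤ → List ℤ
  | [] => []
  | _ :: l => padd l (0 :: pd l)

def n1 : List ℤ → ℕ
  | [] => 0
  | a :: l => a.natAbs + n1 l

def ndk (k : ℕ) : List ℤ → ℕ
  | [] => 0
  | a :: l => k * a.natAbs + ndk (k + 1) l

def evZ : List ℤ → ℤ → ℤ
  | [], _ => 0
  | a :: l, x => a + x * evZ l x

def ylist (i : ℕ) : List ℤ := [4 * (2 * i + 1), 4]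

def pl (i : ℕ) : List ℤ :=
  match i with
  | 1 => p1
  | 2 => p2
  | 3 => p3
  | 4 => p4
  | 5 => p5
  | 6 => p6
  | 7 => p7
  | _ => []

def delta (i : ℕ) : List ℤ := padd (pmul (pl i) (pmul (pl i) (pl i))) (psmul (-(EE : ℤ) ^ 3) (ylist i))

def low : List ℤ → Bool
  | [] => false
  | a :: l => decide ((EE : ℤ) + (n1 l : ℤ) ≤ a)

def Qv : List ℤ :=
  padd (pcomp Q0 [0, 0, 0, 1]) (padd (pmul [0, 1] (pcomp Q1 [0, 0, 0, 1]))
    (pmul [0, 0, 1] (pcomp Q2 [0, 0, 0, 1])))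

def qq : List ℤ := pmul [0, 0, 1] Qv

def Pi (i : ℕ) : List ℤ :=
  psmul 4 (padd (psmul (EE ^ 2) (pcomp Q0 (ylist i)))
    (padd (psmul EE (pmul (pl i) (pcomp Q1 (ylist i))))
      (pmul (pmul (pl i) (pl i)) (pcomp Q2 (ylist i)))))

def Pv : List ℤ := psmul (-3 * EE ^ 2) (pcomp qq [3, 1])

def Ptot : List ℤ :=
  padd Pv (padd (Pi 1) (padd (Pi 2) (padd (Pi 3) (padd (Pi 4) (padd (Pi 5) (padd (Pi 6) (Pi 7)))))))

/-- evaluation point for Kronecker substitution -/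
def XX : ℕ := 2 ^ 1000

/-- balanced digits (an untrusted oracle, its output is checked) -/
def digs : ℕ → ℤ → List ℤ
  | 0, _ => []
  | f + 1, N => Int.bmod N XX :: digs f ((N - Int.bmod N XX) / (XX : ℤ))

/-- majorant of the coefficient norm of a composition -/
def nco : List ℤ → ℕ → ℕ
  | [], _ => 0
  | a :: l, x => a.natAbs + x * nco l x

def kron (d : List ℤ) (N : ℤ) (b : ℕ) : Bool :=
  decide (evZ d XX = N) && Nat.blt (n1 d + b) XX

def NA (i : ℕ) : ℤ := evZ (pl i) XX * (evZ (pl i) XX * evZ (pl i) XX) + -(EE : ℤ) ^ 3 * evZ (ylist i) XX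
def bA (i : ℕ) : ℕ := n1 (pl i) * (n1 (pl i) * n1 (pl i)) + EE ^ 3 * n1 (ylist i)
def dA (i : ℕ) : List ℤ := digs 240 (NA i)

def chkA (i : ℕ) : Bool :=
  low (pl i) && kron (dA i) (NA i) (bA i) && Nat.ble (n1 (dA i) * 10 ^ 38) (EE ^ 3) &&
    Nat.ble (ndk 0 (dA i) * 10 ^ 36) (EE ^ 3)

def NC (Q : List ℤ) (i : ℕ) : ℤ := evZ Q (evZ (ylist i) XX)
def bC (Q : List ℤ) (i : ℕ) : ℕ := nco Q (n1 (ylist i))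
def dC (Q : List ℤ) (i : ℕ) : List ℤ := digs 20 (NC Q i)

def chkC (Q : List ℤ) (i : ℕ) : Bool :=
  kron (dC Q i) (NC Q i) (bC Q i) && Nat.ble (n1 (dC Q i)) (DD * 10 ^ 15) &&
    Nat.ble (ndk 0 (dC Q i)) (DD * 10 ^ 16)

def NQ (x : ℤ) : ℤ := x ^ 2 * (evZ Q0 (x ^ 3) + (x * evZ Q1 (x ^ 3) + x ^ 2 * evZ Q2 (x ^ 3)))
def bQ (x : ℕ) : ℕ := x ^ 2 * (nco Q0 (x ^ 3) + (x * nco Q1 (x ^ 3) + x ^ 2 * nco Q2 (x ^ 3)))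

def NPi (i : ℕ) : ℤ := 4 * ((EE : ℤ) ^ 2 * NC Q0 i + ((EE : ℤ) * (evZ (pl i) XX * NC Q1 i)
  + evZ (pl i) XX * evZ (pl i) XX * NC Q2 i))
def bPi (i : ℕ) : ℕ := 4 * (EE ^ 2 * bC Q0 i + (EE * (n1 (pl i) * bC Q1 i)
  + n1 (pl i) * n1 (pl i) * bC Q2 i))
def NP : ℤ := -3 * (EE : ℤ) ^ 2 * NQ (3 + XX) +
  (NPi 1 + (NPi 2 + (NPi 3 + (NPi 4 + (NPi 5 + (NPi 6 + NPi 7))))))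
def bP : ℕ := 3 * EE ^ 2 * bQ 4 +
  (bPi 1 + (bPi 2 + (bPi 3 + (bPi 4 + (bPi 5 + (bPi 6 + bPi 7))))))
def dP : List ℤ := digs 180 NP
def chkP : Bool := kron dP NP bP && Nat.ble (ndk 0 dP * 10 ^ 18) (4 * DD * EE ^ 2)

def chkG : Bool := kron (pd GG) (MM * NQ XX) (MM * bQ 1)
def chkS : Bool := kron GG (XX * evZ (pd SS) XX) (n1 (pd SS))

end BR

namespace BR

lemma chkA_ok (i : ℕ) (h1 : 1 ≤ i) (h7 : i ≤ 7) : chkA i = true := by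
  have h : ∀ i ∈ [1, 2, 3, 4, 5, 6, 7], chkA i = true := by decide +kernel
  apply h
  interval_cases i <;> simp

lemma chkC1_ok (i : ℕ) (h1 : 1 ≤ i) (h7 : i ≤ 7) : chkC Q1 i = true := by
  have h : ∀ i ∈ [1, 2, 3, 4, 5, 6, 7], chkC Q1 i = true := by decide +kernel
  apply h
  interval_cases i <;> simp

lemma chkC2_ok (i : ℕ) (h1 : 1 ≤ i) (h7 : i ≤ 7) : chkC Q2 i = true := by
  have h : ∀ i ∈ [1, 2, 3, 4, 5, 6, 7], chkC Q2 i = true := by decide +kernel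
  apply h
  interval_cases i <;> simp

lemma chkP_ok : chkP = true := by decide +kernel

lemma chkG_ok : chkG = true := by decide +kernel

lemma chkS_ok : chkS = true := by decide +kernel

end BR

namespace BR

noncomputable def ev : List ℤ → ℝ → ℝ
  | [], _ => 0
  | a :: l, x => a + x * ev l x

lemma ev_padd (a b : List ℤ) (x : ℝ) : ev (padd a b) x = ev a x + ev b x := by
  induction a generalizing b with
  | nil => simp [padd, ev]
  | cons a l ih =>
    cases b with
    | nil => simp [padd, ev]
    | cons b m => simp only [padd, ev, ih]; push_cast; ring

lemma ev_psmul (c : ℤ) (a : List ℤ) (x : ℝ) : ev (psmul c a) x = c * ev a x := by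
  induction a with
  | nil => simp [psmul, ev]
  | cons a l ih => simp only [psmul, ev, ih]; push_cast; ring

lemma ev_pmul (a b : List ℤ) (x : ℝ) : ev (pmul a b) x = ev a x * ev b x := by
  induction a with
  | nil => simp [pmul, ev]
  | cons a l ih => simp only [pmul, ev, ev_padd, ev_psmul, ih]; push_cast; ring

lemma ev_pcomp (a b : List ℤ) (x : ℝ) : ev (pcomp a b) x = ev a (ev b x) := by
  induction a with
  | nil => simp [pcomp, ev]
  | cons a l ih => simp only [pcomp, ev, ev_padd, ev_pmul, ih]; ring

lemma evZ_padd (a b : List ℤ) (x : ℤ) : evZ (padd a b) x = evZ a x + evZ b x := by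
  induction a generalizing b with
  | nil => simp [padd, evZ]
  | cons a l ih =>
    cases b with
    | nil => simp [padd, evZ]
    | cons b m => simp only [padd, evZ, ih]; ring

lemma evZ_psmul (c : ℤ) (a : List ℤ) (x : ℤ) : evZ (psmul c a) x = c * evZ a x := by
  induction a with
  | nil => simp [psmul, evZ]
  | cons a l ih => simp only [psmul, evZ, ih]; ring

lemma evZ_pmul (a b : List ℤ) (x : ℤ) : evZ (pmul a b) x = evZ a x * evZ b x := by
  induction a with
  | nil => simp [pmul, evZ]
  | cons a l ih => simp only [pmul, evZ, evZ_padd, evZ_psmul, ih]; ring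

lemma evZ_pcomp (a b : List ℤ) (x : ℤ) : evZ (pcomp a b) x = evZ a (evZ b x) := by
  induction a with
  | nil => simp [pcomp, evZ]
  | cons a l ih => simp only [pcomp, evZ, evZ_padd, evZ_pmul, ih]; ring

lemma ev_intCast (a : List ℤ) (x : ℤ) : ev a (x : ℝ) = (evZ a x : ℝ) := by
  induction a with
  | nil => simp [ev, evZ]
  | cons a l ih => simp only [ev, evZ, ih]; push_cast; ring

lemma n1_padd (a b : List ℤ) : n1 (padd a b) ≤ n1 a + n1 b := by
  induction a generalizing b with
  | nil => simp [padd, n1]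
  | cons a l ih =>
    cases b with
    | nil => simp [padd, n1]
    | cons b m =>
      simp only [padd, n1]
      have := ih m
      have := Int.natAbs_add_le a b
      omega

lemma n1_psmul (c : ℤ) (a : List ℤ) : n1 (psmul c a) = c.natAbs * n1 a := by
  induction a with
  | nil => simp [psmul, n1]
  | cons a l ih => simp only [psmul, n1, ih, Int.natAbs_mul]; ring

lemma n1_pmul (a b : List ℤ) : n1 (pmul a b) ≤ n1 a * n1 b := by
  induction a with
  | nil => simp [pmul, n1]
  | cons a l ih =>
    simp only [pmul, n1]
    refine (n1_padd _ _).trans ?_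
    rw [n1_psmul]
    simp only [n1, Int.natAbs_zero, zero_add]
    nlinarith

lemma nco_mono (a : List ℤ) {x y : ℕ} (h : x ≤ y) : nco a x ≤ nco a y := by
  induction a with
  | nil => simp [nco]
  | cons a l ih => simp only [nco]; gcongr

lemma n1_pcomp (a b : List ℤ) : n1 (pcomp a b) ≤ nco a (n1 b) := by
  induction a with
  | nil => simp [pcomp, n1, nco]
  | cons a l ih =>
    simp only [pcomp, nco]
    refine (n1_padd _ _).trans ?_
    simp only [n1, add_zero]
    have := n1_pmul b (pcomp l b)
    have := Nat.mul_le_mul_left (n1 b) ih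
    omega

lemma ndk_eq (k : ℕ) (l : List ℤ) : ndk k l = k * n1 l + ndk 0 l := by
  induction l generalizing k with
  | nil => simp [ndk, n1]
  | cons a l ih =>
    simp only [ndk, n1]
    rw [ih (k + 1), ih (0 + 1)]
    ring

lemma n1_pd (l : List ℤ) : n1 (pd l) ≤ ndk 0 l := by
  induction l with
  | nil => simp [pd, n1, ndk]
  | cons a l ih =>
    simp only [pd, ndk]
    rw [ndk_eq (0 + 1)]
    have := n1_padd l (0 :: pd l)
    simp only [n1, Int.natAbs_zero] at this
    omega

lemma abs_ev_le (l : List ℤ) {x : ℝ} (hx : |x| ≤ 1) : |ev l x| ≤ n1 l := by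
  induction l with
  | nil => simp [ev, n1]
  | cons a l ih =>
    simp only [ev, n1]
    refine (abs_add_le _ _).trans ?_
    rw [abs_mul]
    have h1 : |(a : ℝ)| = (a.natAbs : ℝ) := by rw [Nat.cast_natAbs, Int.cast_abs]
    rw [h1]
    push_cast
    have : |x| * |ev l x| ≤ 1 * n1 l := by gcongr
    linarith

lemma ev_hasDerivAt (l : List ℤ) (x : ℝ) : HasDerivAt (ev l) (ev (pd l) x) x := by
  induction l with
  | nil => simpa [ev, pd] using hasDerivAt_const x (0 : ℝ)
  | cons a l ih =>
    have h := ((hasDerivAt_id x).mul ih).const_add (a : ℝ)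
    have e : ev (pd (a :: l)) x = 1 * ev l x + id x * ev (pd l) x := by
      simp only [pd, ev_padd, ev, id]; push_cast; ring
    rw [e]
    exact h

lemma zero_of_small (l : List ℤ) (X : ℕ) (h : n1 l < X) (h0 : evZ l X = 0) (x : ℝ) :
    ev l x = 0 := by
  induction l with
  | nil => simp [ev]
  | cons a l ih =>
    simp only [n1] at h
    simp only [evZ] at h0
    have hd : (X : ℤ) ∣ a := ⟨-evZ l X, by linarith⟩
    have ha : a = 0 := by
      apply Int.eq_zero_of_abs_lt_dvd hd
      rw [Int.abs_eq_natAbs]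
      omega
    subst ha
    have hX : (X : ℤ) ≠ 0 := by omega
    have h1 : evZ l X = 0 := by
      have : (X : ℤ) * evZ l X = 0 := by linarith
      exact (mul_eq_zero.1 this).resolve_left hX
    simp only [ev]
    rw [ih (by omega) h1]
    simp

lemma kron_sound {d l : List ℤ} {N : ℤ} {b : ℕ} (h : kron d N b = true) (hN : evZ l XX = N)
    (hb : n1 l ≤ b) (x : ℝ) : ev l x = ev d x := by
  unfold kron at h
  rw [Bool.and_eq_true, decide_eq_true_eq] at h
  have h2 : n1 d + b < XX := by
    have := h.2
    rwa [Nat.blt_eq] at this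
  have := zero_of_small (padd l (psmul (-1) d)) XX ?_ ?_ x
  · rw [ev_padd, ev_psmul] at this
    push_cast at this
    linarith
  · have h3 := n1_padd l (psmul (-1) d)
    rw [n1_psmul] at h3
    simp only [Int.natAbs_neg, Int.natAbs_one, one_mul] at h3
    omega
  · rw [evZ_padd, evZ_psmul, hN, h.1]
    ring

lemma low_sound {p : List ℤ} (h : low p = true) {x : ℝ} (hx : |x| ≤ 1) : (EE : ℝ) ≤ ev p x := by
  cases p with
  | nil => simp [low] at h
  | cons a l =>
    simp only [low, decide_eq_true_eq] at h
    have h' : (EE : ℝ) + n1 l ≤ a := by exact_mod_cast h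
    simp only [ev]
    have h1 := abs_ev_le l hx
    have h2 : |x * ev l x| ≤ n1 l := by
      rw [abs_mul]
      nlinarith [abs_nonneg (ev l x), abs_nonneg x]
    have := neg_abs_le (x * ev l x)
    linarith

lemma EE_pos : (0 : ℝ) < EE := by unfold EE; positivity
lemma DD_pos : (0 : ℝ) < DD := by unfold DD; positivity

lemma ev_ylist (i : ℕ) (t : ℝ) : ev (ylist i) t = 4 * (2 * i + 1 + t) := by
  simp only [ylist, ev]; push_cast; ring

/-- accuracy of the polynomial approximation of the cube root, in cubed form -/
lemma delta_bounds (i : ℕ) (h1 : 1 ≤ i) (h7 : i ≤ 7) :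
    ∃ d : List ℤ, (∀ t, ev d t = ev (pl i) t ^ 3 - (EE : ℝ) ^ 3 * (4 * (2 * i + 1 + t))) ∧
      (n1 d : ℝ) * 10 ^ 38 ≤ (EE : ℝ) ^ 3 ∧ (n1 (pd d) : ℝ) * 10 ^ 36 ≤ (EE : ℝ) ^ 3 ∧
      ∀ t, |t| ≤ 1 → (EE : ℝ) ≤ ev (pl i) t := by
  have h := chkA_ok i h1 h7
  unfold chkA at h
  simp only [Bool.and_eq_true] at h
  obtain ⟨⟨⟨ha, hb⟩, hc⟩, hd⟩ := h
  have hc' := Nat.le_of_ble_eq_true hc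
  have hd' := Nat.le_of_ble_eq_true hd
  refine ⟨dA i, ?_, by exact_mod_cast hc', ?_, fun t ht => low_sound ha ht⟩
  · intro t
    have := kron_sound (l := delta i) hb (by
      unfold delta NA
      simp only [evZ_padd, evZ_pmul, evZ_psmul]) (by
      unfold delta bA
      refine (n1_padd _ _).trans ?_
      rw [n1_psmul]
      have h1 := n1_pmul (pl i) (pmul (pl i) (pl i))
      have h2 := Nat.mul_le_mul_left (n1 (pl i)) (n1_pmul (pl i) (pl i))
      have h3 : (-(EE : ℤ) ^ 3).natAbs = EE ^ 3 := by
        rw [Int.natAbs_neg, Int.natAbs_pow, Int.natAbs_natCast]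
      rw [h3]
      omega) t
    rw [← this]
    unfold delta
    simp only [ev_padd, ev_pmul, ev_psmul, ev_ylist]
    push_cast
    ring
  · have : n1 (pd (dA i)) * 10 ^ 36 ≤ EE ^ 3 :=
      (Nat.mul_le_mul_right _ (n1_pd _)).trans hd'
    exact_mod_cast this

lemma comp_bounds (Q : List ℤ) (i : ℕ) (h : chkC Q i = true) :
    ∃ d : List ℤ, (∀ t, ev d t = ev Q (4 * (2 * i + 1 + t))) ∧
      (n1 d : ℝ) ≤ DD * 10 ^ 15 ∧ (n1 (pd d) : ℝ) ≤ DD * 10 ^ 16 := by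
  unfold chkC at h
  simp only [Bool.and_eq_true] at h
  obtain ⟨⟨hb, hc⟩, hd⟩ := h
  have hc' := Nat.le_of_ble_eq_true hc
  have hd' := Nat.le_of_ble_eq_true hd
  refine ⟨dC Q i, ?_, by exact_mod_cast hc', by exact_mod_cast (n1_pd _).trans hd'⟩
  intro t
  have := kron_sound (l := pcomp Q (ylist i)) hb (evZ_pcomp _ _ _) (n1_pcomp _ _) t
  rw [← this, ev_pcomp, ev_ylist]

/-- `v^2 Q(v)` -/
noncomputable def qf (v : ℝ) : ℝ := v ^ 2 * (ev Q0 (v ^ 3) + (v * ev Q1 (v ^ 3) + v ^ 2 * ev Q2 (v ^ 3)))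

lemma ev_qq (v : ℝ) : ev qq v = qf v := by
  unfold qq Qv qf
  simp only [ev_pmul, ev_padd, ev_pcomp]
  have h3 : ev [0, 0, 0, 1] v = v ^ 3 := by simp only [ev]; push_cast; ring
  have h2 : ev [0, 0, 1] v = v ^ 2 := by simp only [ev]; push_cast; ring
  have h1 : ev [0, 1] v = v := by simp only [ev]; push_cast; ring
  rw [h1, h2, h3]

lemma evZ_qq (v : ℤ) : evZ qq v = NQ v := by
  unfold qq Qv NQ
  simp only [evZ_pmul, evZ_padd, evZ_pcomp]
  have h3 : evZ [0, 0, 0, 1] v = v ^ 3 := by simp only [evZ]; ring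
  have h2 : evZ [0, 0, 1] v = v ^ 2 := by simp only [evZ]; ring
  have h1 : evZ [0, 1] v = v := by simp only [evZ]; ring
  rw [h1, h2, h3]

lemma nco_padd (a b : List ℤ) (x : ℕ) : nco (padd a b) x ≤ nco a x + nco b x := by
  induction a generalizing b with
  | nil => simp [padd, nco]
  | cons a l ih =>
    cases b with
    | nil => simp [padd, nco]
    | cons b m =>
      simp only [padd, nco]
      have h1 := Nat.mul_le_mul_left x (ih m)
      have h2 := Int.natAbs_add_le a b
      rw [mul_add] at h1
      omega

lemma nco_psmul (c : ℤ) (a : List ℤ) (x : ℕ) : nco (psmul c a) x = c.natAbs * nco a x := by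
  induction a with
  | nil => simp [psmul, nco]
  | cons a l ih => simp only [psmul, nco, ih, Int.natAbs_mul]; ring

lemma nco_pmul (a b : List ℤ) (x : ℕ) : nco (pmul a b) x ≤ nco a x * nco b x := by
  induction a with
  | nil => simp [pmul, nco]
  | cons a l ih =>
    simp only [pmul, nco]
    refine (nco_padd _ _ _).trans ?_
    rw [nco_psmul]
    simp only [nco, Int.natAbs_zero, zero_add]
    have := Nat.mul_le_mul_left x ih
    nlinarith

lemma nco_pcomp (a b : List ℤ) (x : ℕ) : nco (pcomp a b) x ≤ nco a (nco b x) := by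
  induction a with
  | nil => simp [pcomp, nco]
  | cons a l ih =>
    simp only [pcomp, nco]
    refine (nco_padd _ _ _).trans ?_
    simp only [nco, mul_zero, add_zero]
    have := nco_pmul b (pcomp l b) x
    have := Nat.mul_le_mul_left (nco b x) ih
    omega

lemma nco_one (a : List ℤ) : nco a 1 = n1 a := by
  induction a with
  | nil => simp [nco, n1]
  | cons a l ih => simp only [nco, n1, ih, one_mul]

lemma nco_qq (x : ℕ) : nco qq x ≤ bQ x := by
  have h3 : nco [0, 0, 0, 1] x = x ^ 3 := by simp only [nco, Int.natAbs_zero, Int.natAbs_one]; ring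
  have h2 : nco [0, 0, 1] x = x ^ 2 := by simp only [nco, Int.natAbs_zero, Int.natAbs_one]; ring
  have h1 : nco [0, 1] x = x := by simp only [nco, Int.natAbs_zero, Int.natAbs_one]; ring
  unfold qq Qv bQ
  refine (nco_pmul _ _ _).trans ?_
  rw [h2]
  apply Nat.mul_le_mul_left
  refine (nco_padd _ _ _).trans (add_le_add ?_ ((nco_padd _ _ _).trans (add_le_add ?_ ?_)))
  · refine (nco_pcomp _ _ _).trans ?_
    rw [h3]
  · refine (nco_pmul _ _ _).trans ?_
    rw [h1]
    apply Nat.mul_le_mul_left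
    refine (nco_pcomp _ _ _).trans ?_
    rw [h3]
  · refine (nco_pmul _ _ _).trans ?_
    rw [h2]
    apply Nat.mul_le_mul_left
    refine (nco_pcomp _ _ _).trans ?_
    rw [h3]

lemma evZ_Pi (i : ℕ) : evZ (Pi i) XX = NPi i := by
  unfold Pi NPi NC
  simp only [evZ_psmul, evZ_padd, evZ_pmul, evZ_pcomp]

lemma n1_Pi (i : ℕ) : n1 (Pi i) ≤ bPi i := by
  unfold Pi bPi bC
  rw [n1_psmul]
  apply Nat.mul_le_mul_left
  refine (n1_padd _ _).trans (add_le_add ?_ ((n1_padd _ _).trans (add_le_add ?_ ?_)))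
  · rw [n1_psmul, Int.natAbs_pow, Int.natAbs_natCast]
    exact Nat.mul_le_mul_left _ (n1_pcomp _ _)
  · rw [n1_psmul, Int.natAbs_natCast]
    exact Nat.mul_le_mul_left _ ((n1_pmul _ _).trans (Nat.mul_le_mul_left _ (n1_pcomp _ _)))
  · exact (n1_pmul _ _).trans (Nat.mul_le_mul (n1_pmul _ _) (n1_pcomp _ _))

lemma P_bounds : ∃ d : List ℤ, (∀ t, ev d t = ev Ptot t) ∧
    (n1 (pd d) : ℝ) * 10 ^ 18 ≤ 4 * DD * (EE : ℝ) ^ 2 := by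
  have h := chkP_ok
  unfold chkP at h
  simp only [Bool.and_eq_true] at h
  have hd' := Nat.le_of_ble_eq_true h.2
  refine ⟨dP, ?_, by exact_mod_cast (Nat.mul_le_mul_right _ (n1_pd _)).trans hd'⟩
  intro t
  symm
  apply kron_sound h.1
  · unfold Ptot NP Pv
    simp only [evZ_padd, evZ_psmul, evZ_pcomp, evZ_Pi, evZ_qq]
    have : evZ [3, 1] XX = 3 + XX := by simp only [evZ]; ring
    rw [this]
  · unfold Ptot bP Pv
    refine (n1_padd _ _).trans (add_le_add ?_ ?_)
    · rw [n1_psmul]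
      have h3 : (-3 * (EE : ℤ) ^ 2).natAbs = 3 * EE ^ 2 := by
        rw [Int.natAbs_mul, Int.natAbs_pow, Int.natAbs_natCast]
        rfl
      rw [h3]
      apply Nat.mul_le_mul_left
      exact (n1_pcomp _ _).trans (nco_qq 4)
    · refine (n1_padd _ _).trans (add_le_add (n1_Pi _) ?_)
      refine (n1_padd _ _).trans (add_le_add (n1_Pi _) ?_)
      refine (n1_padd _ _).trans (add_le_add (n1_Pi _) ?_)
      refine (n1_padd _ _).trans (add_le_add (n1_Pi _) ?_)
      refine (n1_padd _ _).trans (add_le_add (n1_Pi _) ?_)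
      exact (n1_padd _ _).trans (add_le_add (n1_Pi _) (n1_Pi _))

lemma GG_deriv (v : ℝ) : ev (pd GG) v = MM * qf v := by
  have h := chkG_ok
  unfold chkG at h
  have := kron_sound (l := psmul MM qq) h (by rw [evZ_psmul, evZ_qq])
    (by
      rw [n1_psmul, Int.natAbs_natCast, ← nco_one]
      exact Nat.mul_le_mul_left _ (nco_qq 1)) v
  rw [← this, ev_psmul, ev_qq]
  push_cast
  rfl

lemma SS_deriv (v : ℝ) : v * ev (pd SS) v = ev GG v := by
  have h := chkS_ok
  unfold chkS at h
  have := kron_sound (l := 0 :: pd SS) h (by simp only [evZ]; ring) (by simp [n1]) v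
  rw [← this]
  simp only [ev]
  push_cast
  ring

end BR

namespace BR

/-- the pointwise estimate behind the branch error -/
lemma branch_alg {D z p z' p' δ δ' B B' C C' : ℝ} (hD : 0 < D) (hz : 2 ≤ z) (hz4 : z ≤ 4)
    (hp : 1 ≤ p) (hδ : p ^ 3 - z ^ 3 = δ) (hδb : |δ| ≤ 1 / 10 ^ 38) (hz' : 3 * z ^ 2 * z' = 4)
    (hp' : 3 * p ^ 2 * p' = 4 + δ') (hδ' : |δ'| ≤ 1 / 10 ^ 36)
    (hB : |B| ≤ D * 10 ^ 15) (hC : |C| ≤ D * 10 ^ 15)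
    (hB' : |B'| ≤ D * 10 ^ 16) (hC' : |C'| ≤ D * 10 ^ 16) :
    |(z' - p') * B + (z - p) * B' + ((2 * z * z' - 2 * p * p') * C + (z ^ 2 - p ^ 2) * C')|
      ≤ D * (2 / 10 ^ 20) := by
  have hw : |z - p| ≤ 1 / 10 ^ 38 := by
    have e : (z - p) * (z ^ 2 + z * p + p ^ 2) = -δ := by rw [← hδ]; ring
    have e2 : |z - p| * (z ^ 2 + z * p + p ^ 2) = |δ| := by
      rw [← abs_neg δ, ← e, abs_mul, abs_of_pos (a := z ^ 2 + z * p + p ^ 2) (by positivity)]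
    have : 1 ≤ z ^ 2 + z * p + p ^ 2 := by nlinarith
    nlinarith [abs_nonneg (z - p)]
  have hp5 : p ≤ 5 := by
    have := abs_le.1 hw
    norm_num at this
    linarith [this.1]
  have hz'0 : 0 ≤ z' := by
    by_contra h
    push Not at h
    nlinarith [sq_nonneg z, mul_nonneg (sq_nonneg z) (neg_pos.2 h).le]
  have hz'1 : z' ≤ 1 / 3 := by nlinarith [mul_nonneg (show 0 ≤ z ^ 2 - 4 by nlinarith) hz'0]
  have hzp : |z + p| ≤ 9 := by rw [abs_of_nonneg (by linarith)]; linarith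
  have hsq : |z ^ 2 - p ^ 2| ≤ 9 / 10 ^ 38 := by
    have : z ^ 2 - p ^ 2 = (z - p) * (z + p) := by ring
    rw [this, abs_mul]
    have := mul_le_mul hw hzp (abs_nonneg _) (by positivity)
    linarith
  have hd : |z' - p'| ≤ 1 / 10 ^ 36 := by
    have e : 3 * p ^ 2 * (z' - p') = -δ' + -(3 * z' * (z ^ 2 - p ^ 2)) := by
      linear_combination hz' - hp'
    have e2 : 3 * p ^ 2 * |z' - p'| ≤ |δ'| + 3 * z' * |z ^ 2 - p ^ 2| := by
      have h := abs_add_le (-δ') (-(3 * z' * (z ^ 2 - p ^ 2)))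
      rw [← e, abs_neg, abs_neg, abs_mul, abs_mul (3 * z'), abs_of_nonneg (a := 3 * z') (by positivity),
        abs_of_pos (a := 3 * p ^ 2) (by positivity)] at h
      exact h
    have e3 : 3 * z' * |z ^ 2 - p ^ 2| ≤ 1 * (9 / 10 ^ 38) := by
      apply mul_le_mul _ hsq (abs_nonneg _) (by norm_num)
      linarith
    have e4 : 3 * |z' - p'| ≤ 3 * p ^ 2 * |z' - p'| := by
      apply mul_le_mul_of_nonneg_right _ (abs_nonneg _)
      nlinarith
    have : 3 * |z' - p'| ≤ 1 / 10 ^ 36 + 9 / 10 ^ 38 := by linarith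
    norm_num at this ⊢
    linarith
  have hp'1 : |p'| ≤ 1 := by
    have h := abs_le.1 hd
    norm_num at h
    rw [abs_le]
    constructor <;> linarith [h.1, h.2]
  have hzz : |2 * z * z' - 2 * p * p'| ≤ 9 / 10 ^ 36 := by
    have e : 2 * z * z' - 2 * p * p' = 2 * z * (z' - p') + (z - p) * (2 * p') := by ring
    rw [e]
    refine (abs_add_le _ _).trans ?_
    rw [abs_mul, abs_mul (z - p), abs_of_nonneg (a := 2 * z) (by linarith), abs_mul 2, abs_two]
    have h1 : 2 * z * |z' - p'| ≤ 8 * (1 / 10 ^ 36) :=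
      mul_le_mul (by linarith) hd (abs_nonneg _) (by norm_num)
    have h2 : |z - p| * (2 * |p'|) ≤ 1 / 10 ^ 38 * 2 :=
      mul_le_mul hw (by linarith) (by positivity) (by norm_num)
    norm_num at h1 h2 ⊢
    linarith
  have t1 : |(z' - p') * B| ≤ 1 / 10 ^ 36 * (D * 10 ^ 15) := by
    rw [abs_mul]; exact mul_le_mul hd hB (abs_nonneg _) (by norm_num)
  have t2 : |(z - p) * B'| ≤ 1 / 10 ^ 38 * (D * 10 ^ 16) := by
    rw [abs_mul]; exact mul_le_mul hw hB' (abs_nonneg _) (by norm_num)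
  have t3 : |(2 * z * z' - 2 * p * p') * C| ≤ 9 / 10 ^ 36 * (D * 10 ^ 15) := by
    rw [abs_mul]; exact mul_le_mul hzz hC (abs_nonneg _) (by norm_num)
  have t4 : |(z ^ 2 - p ^ 2) * C'| ≤ 9 / 10 ^ 38 * (D * 10 ^ 16) := by
    rw [abs_mul]; exact mul_le_mul hsq hC' (abs_nonneg _) (by norm_num)
  refine (abs_add_le _ _).trans ?_
  have a1 := abs_add_le ((z' - p') * B) ((z - p) * B')
  have a2 := abs_add_le ((2 * z * z' - 2 * p * p') * C) ((z ^ 2 - p ^ 2) * C')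
  linarith

/-- twice the cube root, in the symmetric variable -/
noncomputable def zf (i : ℕ) (t : ℝ) : ℝ := 2 * cr ((t + 1) / 2 + i)

/-- error of replacing the cube root by the polynomial on branch `i` -/
noncomputable def gf (i : ℕ) (t : ℝ) : ℝ :=
  (zf i t - ev (pl i) t / EE) * ev Q1 (4 * (2 * i + 1 + t)) +
    (zf i t ^ 2 - (ev (pl i) t / EE) ^ 2) * ev Q2 (4 * (2 * i + 1 + t))

lemma zf_cube {i : ℕ} (h1 : 1 ≤ i) {t : ℝ} (ht : |t| ≤ 1) :
    zf i t ^ 3 = 4 * (2 * i + 1 + t) := by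
  have h1' : (1 : ℝ) ≤ i := by exact_mod_cast h1
  have := abs_le.1 ht
  unfold zf
  rw [mul_pow, cr_pow (by linarith)]
  ring

lemma gf_deriv (i : ℕ) (h1 : 1 ≤ i) (h7 : i ≤ 7) {t : ℝ} (ht : |t| ≤ 1) :
    ∃ g', HasDerivAt (gf i) g' t ∧ |g'| ≤ DD * (2 / 10 ^ 20) := by
  have h1' : (1 : ℝ) ≤ i := by exact_mod_cast h1
  have h7' : (i : ℝ) ≤ 7 := by exact_mod_cast h7
  have htt := abs_le.1 ht
  obtain ⟨d, hd, hdn, hdn', hlow⟩ := delta_bounds i h1 h7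
  obtain ⟨b, hb, hbn, hbn'⟩ := comp_bounds Q1 i (chkC1_ok i h1 h7)
  obtain ⟨c, hc, hcn, hcn'⟩ := comp_bounds Q2 i (chkC2_ok i h1 h7)
  have hE := EE_pos
  have hpos : 0 < (t + 1) / 2 + (i : ℝ) := by linarith
  have hzd : HasDerivAt (zf i) (2 * (1 / (3 * cr ((t + 1) / 2 + i) ^ 2) * (1 / 2))) t := by
    have h0 : HasDerivAt (fun t : ℝ => (t + 1) / 2 + (i : ℝ)) (1 / 2) t :=
      (((hasDerivAt_id t).add_const (1 : ℝ)).div_const 2).add_const (i : ℝ)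
    exact ((cr_hasDerivAt hpos).comp t h0).const_mul 2
  have hpd : HasDerivAt (fun t => ev (pl i) t / EE) (ev (pd (pl i)) t / EE) t :=
    (ev_hasDerivAt (pl i) t).div_const _
  have hbd := ev_hasDerivAt b t
  have hcd := ev_hasDerivAt c t
  have hg : gf i = fun t => (zf i t - ev (pl i) t / EE) * ev b t +
      (zf i t ^ 2 - (ev (pl i) t / EE) ^ 2) * ev c t := by
    funext t
    unfold gf
    rw [hb, hc]
  set z := zf i t with hzdef
  set p := ev (pl i) t / EE with hpdef
  set z' := 2 * (1 / (3 * cr ((t + 1) / 2 + i) ^ 2) * (1 / 2)) with hz'def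
  set p' := ev (pd (pl i)) t / EE with hp'def
  refine ⟨(z' - p') * ev b t + (z - p) * ev (pd b) t +
    ((2 * z * z' - 2 * p * p') * ev c t + (z ^ 2 - p ^ 2) * ev (pd c) t), ?_, ?_⟩
  · rw [hg]
    have h := ((hzd.sub hpd).mul hbd).add (((hzd.pow 2).sub (hpd.pow 2)).mul hcd)
    refine (h.congr_deriv ?_)
    simp only [Pi.sub_apply, Pi.pow_apply, ← hzdef, ← hpdef]
    push_cast
    ring
  · have hcp := cr_pos hpos
    have hz2 : 2 ≤ z := by
      have := le_cr (r := 1) hpos.le (by linarith)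
      rw [hzdef]; unfold zf; linarith
    have hz4 : z ≤ 4 := by
      have := cr_le (r := 2) (by norm_num) hpos.le (by linarith)
      rw [hzdef]; unfold zf; linarith
    have hE3 : (0 : ℝ) < (EE : ℝ) ^ 3 := by positivity
    -- derivative of the cubed identity
    have hdd : ev (pd d) t = 3 * ev (pl i) t ^ 2 * ev (pd (pl i)) t - (EE : ℝ) ^ 3 * 4 := by
      have e1 := ev_hasDerivAt d t
      have e2 : HasDerivAt (ev d)
          (((3 : ℕ) : ℝ) * ev (pl i) t ^ (3 - 1) * ev (pd (pl i)) t - (EE : ℝ) ^ 3 * (4 * 1)) t := by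
        have : ev d = fun t => ev (pl i) t ^ 3 - (EE : ℝ) ^ 3 * (4 * (2 * i + 1 + t)) := funext hd
        rw [this]
        exact ((ev_hasDerivAt (pl i) t).pow 3).sub
          ((((hasDerivAt_id t).const_add (2 * (i : ℝ) + 1)).const_mul 4).const_mul _)
      have := e1.unique e2
      rw [this]
      push_cast
      ring
    have hbnd : ∀ (a : ℝ) (n : ℕ) (k : ℕ), |a| ≤ n → (n : ℝ) * 10 ^ k ≤ (EE : ℝ) ^ 3 →
        |a / (EE : ℝ) ^ 3| ≤ 1 / 10 ^ k := by
      intro a n k ha hn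
      rw [abs_div, abs_of_pos hE3, div_le_div_iff₀ hE3 (by positivity), one_mul]
      exact (mul_le_mul_of_nonneg_right ha (by positivity)).trans hn
    refine branch_alg (δ := ev d t / (EE : ℝ) ^ 3) (δ' := ev (pd d) t / (EE : ℝ) ^ 3) DD_pos hz2 hz4
      ?_ ?_ ?_ ?_ ?_ ?_ ?_ ?_ ?_ ?_
    · rw [hpdef, le_div_iff₀ hE, one_mul]
      exact hlow t ht
    · rw [hzdef, zf_cube h1 ht, hd, hpdef]
      field_simp
    · exact hbnd _ _ _ (abs_ev_le d ht) hdn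
    · rw [hzdef, hz'def]
      unfold zf
      generalize cr ((t + 1) / 2 + i) = w at hcp
      field_simp
      norm_num
    · rw [hdd, hpdef, hp'def]
      field_simp
      ring
    · exact hbnd _ _ _ (abs_ev_le _ ht) hdn'
    · exact (abs_ev_le _ ht).trans hbn
    · exact (abs_ev_le _ ht).trans hcn
    · exact (abs_ev_le _ ht).trans hbn'
    · exact (abs_ev_le _ ht).trans hcn'

end BR

namespace BR

/-- approximate invariant density -/
noncomputable def ht (x : ℝ) : ℝ := 3 / (4 * (DD : ℝ)) * qf (2 * x + 2)

lemma ev_continuous (l : List ℤ) : Continuous (ev l) :=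
  continuous_iff_continuousAt.2 fun x => (ev_hasDerivAt l x).continuousAt

lemma ht_hasDerivAt (x : ℝ) :
    HasDerivAt ht (3 / (4 * (DD : ℝ)) * (ev (pd qq) (2 * x + 2) * 2)) x := by
  have e : ht = fun x => 3 / (4 * (DD : ℝ)) * ev qq (2 * x + 2) := by
    funext x; unfold ht; rw [ev_qq]
  rw [e]
  have h0 : HasDerivAt (fun x : ℝ => 2 * x + 2) 2 x := by
    simpa using ((hasDerivAt_id x).const_mul (2 : ℝ)).add_const (2 : ℝ)
  exact ((ev_hasDerivAt qq (2 * x + 2)).comp x h0).const_mul _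

lemma ht_lip : ∃ K, 0 ≤ K ∧ IsLip K ht := by
  have hc : Continuous fun x : ℝ => 3 / (4 * (DD : ℝ)) * (ev (pd qq) (2 * x + 2) * 2) := by
    have := ev_continuous (pd qq)
    fun_prop
  obtain ⟨C, hC⟩ := (isCompact_Icc (a := (0 : ℝ)) (b := 1)).exists_bound_of_continuousOn
    hc.continuousOn
  refine ⟨max C 0, le_max_right _ _, ?_⟩
  intro x hx y hy
  have := Convex.norm_image_sub_le_of_norm_hasDerivWithin_le (f := ht)
    (s := Set.Icc (0 : ℝ) 1) (C := max C 0)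
    (fun x _ => (ht_hasDerivAt x).hasDerivWithinAt)
    (fun x hx => (hC x hx).trans (le_max_left _ _)) (convex_Icc 0 1) hy hx
  simpa [Real.norm_eq_abs] using this

lemma branch_value {i : ℕ} (h1 : 1 ≤ i) {t : ℝ} (ht' : |t| ≤ 1) :
    4 * (EE : ℝ) ^ 2 * DD * (ht (br i ((t + 1) / 2)) / (3 * cr ((t + 1) / 2 + i) ^ 2)) =
      ev (Pi i) t + 4 * (EE : ℝ) ^ 2 * gf i t := by
  have h1' : (1 : ℝ) ≤ i := by exact_mod_cast h1
  have htt := abs_le.1 ht'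
  have hpos : 0 < (t + 1) / 2 + (i : ℝ) := by linarith
  have hcp := cr_pos hpos
  have hz3 := zf_cube h1 ht'
  have hE := EE_pos
  have hD := DD_pos
  have e1 : 2 * br i ((t + 1) / 2) + 2 = zf i t := by unfold br zf; ring
  have e2 : cr ((t + 1) / 2 + i) = zf i t / 2 := by unfold zf; ring
  have hzp : 0 < zf i t := by unfold zf; linarith
  unfold ht
  rw [e1, e2]
  unfold qf Pi gf
  rw [hz3]
  simp only [ev_psmul, ev_padd, ev_pmul, ev_pcomp, ev_ylist]
  push_cast
  field_simp
  ring

lemma total_value {t : ℝ} (ht' : |t| ≤ 1) :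
    4 * (EE : ℝ) ^ 2 * DD * (Lop ht ((t + 1) / 2) - ht ((t + 1) / 2)) =
      ev Ptot t + 4 * (EE : ℝ) ^ 2 * ∑ i ∈ Finset.Icc (1 : ℕ) 7, gf i t := by
  have hD := DD_pos
  have hv : 4 * (EE : ℝ) ^ 2 * DD * ht ((t + 1) / 2) = -ev Pv t := by
    unfold ht Pv
    rw [ev_psmul, ev_pcomp, ev_qq]
    have : ev [3, 1] t = 2 * ((t + 1) / 2) + 2 := by simp only [ev]; push_cast; ring
    rw [this]
    push_cast
    field_simp
  have hs : ∑ i ∈ Finset.Icc (1 : ℕ) 7, ev (Pi i) t = ev Pv t * 0 + (ev (Pi 1) t + (ev (Pi 2) t +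
      (ev (Pi 3) t + (ev (Pi 4) t + (ev (Pi 5) t + (ev (Pi 6) t + ev (Pi 7) t)))))) := by
    have : Finset.Icc (1 : ℕ) 7 = {1, 2, 3, 4, 5, 6, 7} := by decide
    rw [this]
    simp
  have hP : ev Ptot t = ev Pv t + ∑ i ∈ Finset.Icc (1 : ℕ) 7, ev (Pi i) t := by
    rw [hs]
    unfold Ptot
    simp only [ev_padd]
    ring
  rw [mul_sub, hv, hP, Lop, Finset.mul_sum]
  rw [Finset.sum_congr rfl (fun i hi => branch_value (Finset.mem_Icc.1 hi).1 ht')]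
  rw [Finset.sum_add_distrib, Finset.mul_sum]
  ring

lemma err_lip : IsLip (3 / 10 ^ 18) (fun x => Lop ht x - ht x) := by
  have hE := EE_pos
  have hD := DD_pos
  obtain ⟨d, hd, hdn⟩ := P_bounds
  set F : ℝ → ℝ := fun t => ev d t + 4 * (EE : ℝ) ^ 2 * ∑ i ∈ Finset.Icc (1 : ℕ) 7, gf i t with hF
  have hder : ∀ t : ℝ, |t| ≤ 1 → ∃ F', HasDerivAt F F' t ∧
      |F'| ≤ 4 * DD * (EE : ℝ) ^ 2 * (3 / 2 / 10 ^ 18) := by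
    intro t ht'
    have hg : ∀ i : ℕ, ∃ g', i ∈ Finset.Icc (1 : ℕ) 7 →
        HasDerivAt (gf i) g' t ∧ |g'| ≤ DD * (2 / 10 ^ 20) := by
      intro i
      by_cases hi : i ∈ Finset.Icc (1 : ℕ) 7
      · obtain ⟨g', h⟩ := gf_deriv i (Finset.mem_Icc.1 hi).1 (Finset.mem_Icc.1 hi).2 ht'
        exact ⟨g', fun _ => h⟩
      · exact ⟨0, fun h => absurd h hi⟩
    choose g' hg' using hg
    refine ⟨ev (pd d) t + 4 * (EE : ℝ) ^ 2 * ∑ i ∈ Finset.Icc (1 : ℕ) 7, g' i, ?_, ?_⟩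
    · refine (ev_hasDerivAt d t).add (HasDerivAt.const_mul _ ?_)
      exact HasDerivAt.fun_sum fun i hi => (hg' i hi).1
    · refine (abs_add_le _ _).trans ?_
      have a1 := abs_ev_le (pd d) ht'
      have a2 : |∑ i ∈ Finset.Icc (1 : ℕ) 7, g' i| ≤ 7 * (DD * (2 / 10 ^ 20)) := by
        refine (Finset.abs_sum_le_sum_abs _ _).trans ?_
        refine (Finset.sum_le_sum fun i hi => (hg' i hi).2).trans ?_
        simp
      rw [abs_mul, abs_of_pos (a := 4 * (EE : ℝ) ^ 2) (by positivity)]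
      have a3 : 4 * (EE : ℝ) ^ 2 * |∑ i ∈ Finset.Icc (1 : ℕ) 7, g' i| ≤
          4 * (EE : ℝ) ^ 2 * (7 * (DD * (2 / 10 ^ 20))) :=
        mul_le_mul_of_nonneg_left a2 (by positivity)
      have a4 : (n1 (pd d) : ℝ) ≤ 4 * DD * (EE : ℝ) ^ 2 / 10 ^ 18 := by
        rw [le_div_iff₀ (by positivity)]; exact hdn
      have hX : 0 < 4 * DD * (EE : ℝ) ^ 2 := by positivity
      linarith
  choose! F' hF' using hder
  have hsub : ∀ t ∈ Set.Icc (-1 : ℝ) 1, |t| ≤ 1 := fun t ht' => abs_le.2 ht'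
  intro x hx y hy
  have hxt : |2 * x - 1| ≤ 1 := by rw [abs_le]; constructor <;> linarith [hx.1, hx.2]
  have hyt : |2 * y - 1| ≤ 1 := by rw [abs_le]; constructor <;> linarith [hy.1, hy.2]
  have key := Convex.norm_image_sub_le_of_norm_hasDerivWithin_le (f := F) (f' := F')
    (s := Set.Icc (-1 : ℝ) 1) (C := 4 * DD * (EE : ℝ) ^ 2 * (3 / 2 / 10 ^ 18))
    (fun t ht' => (hF' t (hsub t ht')).1.hasDerivWithinAt)
    (fun t ht' => (hF' t (hsub t ht')).2) (convex_Icc _ _) (abs_le.1 hyt) (abs_le.1 hxt)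
  have ex := total_value hxt
  have ey := total_value hyt
  have fx : F (2 * x - 1) = 4 * (EE : ℝ) ^ 2 * DD * (Lop ht x - ht x) := by
    have : (2 * x - 1 + 1) / 2 = x := by ring
    rw [this] at ex
    rw [ex, hF]
    simp only [hd]
  have fy : F (2 * y - 1) = 4 * (EE : ℝ) ^ 2 * DD * (Lop ht y - ht y) := by
    have : (2 * y - 1 + 1) / 2 = y := by ring
    rw [this] at ey
    rw [ey, hF]
    simp only [hd]
  rw [fx, fy, ← mul_sub, Real.norm_eq_abs, Real.norm_eq_abs, abs_mul,
    abs_of_pos (a := 4 * (EE : ℝ) ^ 2 * DD) (by positivity)] at key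
  have e2 : |2 * x - 1 - (2 * y - 1)| = 2 * |x - y| := by
    have : 2 * x - 1 - (2 * y - 1) = 2 * (x - y) := by ring
    rw [this, abs_mul, abs_two]
  rw [e2] at key
  have hX : 0 < 4 * (EE : ℝ) ^ 2 * DD := by positivity
  have : 4 * (EE : ℝ) ^ 2 * DD * |Lop ht x - ht x - (Lop ht y - ht y)| ≤
      4 * (EE : ℝ) ^ 2 * DD * (3 / 10 ^ 18 * |x - y|) := by
    refine key.trans (le_of_eq ?_)
    ring
  exact le_of_mul_le_mul_left this hX

/-! the two integrals -/

lemma integral_nu (f F : ℝ → ℝ) (hF : ∀ x ∈ Set.Icc (0 : ℝ) 1, HasDerivAt F (f x) x)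
    (hf : ContinuousOn f (Set.Icc (0 : ℝ) 1)) : ∫ x, f x ∂nu = F 1 - F 0 := by
  unfold nu
  rw [integral_Ico_eq_integral_Ioc, ← intervalIntegral.integral_of_le zero_le_one]
  apply intervalIntegral.integral_eq_sub_of_hasDerivAt
  · intro x hx
    rw [Set.uIcc_of_le zero_le_one] at hx
    exact hF x hx
  · apply ContinuousOn.intervalIntegrable
    rw [Set.uIcc_of_le zero_le_one]
    exact hf

lemma MM_pos : (0 : ℝ) < MM := by
  have : 0 < MM := by decide +kernel
  exact_mod_cast this

lemma ht_continuous : Continuous ht :=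
  continuous_iff_continuousAt.2 fun x => (ht_hasDerivAt x).continuousAt

lemma lin_hasDerivAt (x : ℝ) : HasDerivAt (fun x : ℝ => 2 * x + 2) 2 x := by
  simpa using ((hasDerivAt_id x).const_mul (2 : ℝ)).add_const (2 : ℝ)

lemma int_ht : ∫ x, ht x ∂nu = 3 / (8 * (DD : ℝ) * MM) * (ev GG 4 - ev GG 2) := by
  have hM := MM_pos
  have hD := DD_pos
  rw [integral_nu ht (fun x => 3 / (8 * (DD : ℝ) * MM) * ev GG (2 * x + 2)) _
    ht_continuous.continuousOn]
  · norm_num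
    ring
  · intro x _
    have h := ((ev_hasDerivAt GG (2 * x + 2)).comp x (lin_hasDerivAt x)).const_mul
      (3 / (8 * (DD : ℝ) * MM))
    refine h.congr_deriv ?_
    rw [GG_deriv]
    unfold ht
    field_simp
    ring

lemma log_split {x : ℝ} (hx : 0 ≤ x) :
    Real.log (3 * (x + 1) ^ 2) = (Real.log 3 - 2 * Real.log 2) + 2 * Real.log (2 * x + 2) := by
  have : 2 * x + 2 = 2 * (x + 1) := by ring
  rw [this, Real.log_mul (by norm_num) (by positivity), Real.log_mul (by norm_num) (by positivity),
    Real.log_pow]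
  push_cast
  ring

lemma int_log_ht : ∫ x, Real.log (3 * (x + 1) ^ 2) * ht x ∂nu =
    3 / (8 * (DD : ℝ) * MM) * ((Real.log 3 - 2 * Real.log 2) * (ev GG 4 - ev GG 2) +
      2 * (ev GG 4 * (2 * Real.log 2) - ev GG 2 * Real.log 2 - (ev SS 4 - ev SS 2))) := by
  have hM := MM_pos
  have hD := DD_pos
  rw [integral_nu (fun x => Real.log (3 * (x + 1) ^ 2) * ht x)
    (fun x => 3 / (8 * (DD : ℝ) * MM) * ((Real.log 3 - 2 * Real.log 2) * ev GG (2 * x + 2) +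
      2 * (ev GG (2 * x + 2) * Real.log (2 * x + 2) - ev SS (2 * x + 2))))]
  · have h4 : Real.log 4 = 2 * Real.log 2 := by
      rw [show (4 : ℝ) = 2 ^ 2 by norm_num, Real.log_pow]; push_cast; ring
    have e1 : (2 : ℝ) * 1 + 2 = 4 := by norm_num
    have e0 : (2 : ℝ) * 0 + 2 = 2 := by norm_num
    simp only [e1, e0, h4]
    ring
  · intro x hx
    have hv : 0 < 2 * x + 2 := by linarith [hx.1]
    have hG := (ev_hasDerivAt GG (2 * x + 2)).comp x (lin_hasDerivAt x)
    have hS := (ev_hasDerivAt SS (2 * x + 2)).comp x (lin_hasDerivAt x)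
    have hL := (lin_hasDerivAt x).log hv.ne'
    have h := ((hG.const_mul (Real.log 3 - 2 * Real.log 2)).add
      (((hG.mul hL).sub hS).const_mul 2)).const_mul (3 / (8 * (DD : ℝ) * MM))
    refine h.congr_deriv ?_
    have hs : ev GG (2 * x + 2) / (2 * x + 2) = ev (pd SS) (2 * x + 2) := by
      rw [← SS_deriv, mul_div_cancel_left₀ _ hv.ne']
    rw [log_split hx.1]
    simp only [Function.comp_apply]
    rw [GG_deriv]
    have : ev GG (2 * x + 2) * (2 / (2 * x + 2)) = 2 * ev (pd SS) (2 * x + 2) := by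
      rw [← hs]; ring
    rw [this]
    unfold ht
    field_simp
    ring
  · apply ContinuousOn.mul _ ht_continuous.continuousOn
    apply ContinuousOn.log (by fun_prop)
    intro x hx
    have := hx.1
    positivity

end BR

namespace BR

lemma log_bounds : |Real.log 2 - 0.6931471805599453094172321| ≤ 1 / 10 ^ 20 ∧
    |Real.log 3 - 1.0986122886681096913952452| ≤ 1 / 10 ^ 20 := by
  have h1 := Real.abs_log_sub_add_sum_range_le (x := 1 / 4) (by rw [abs_of_pos] <;> norm_num) 36
  have h2 := Real.abs_log_sub_add_sum_range_le (x := 1 / 9) (by rw [abs_of_pos] <;> norm_num) 24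
  rw [abs_of_pos (a := (1 / 4 : ℝ)) (by norm_num)] at h1
  rw [abs_of_pos (a := (1 / 9 : ℝ)) (by norm_num)] at h2
  have e1 : Real.log (1 - 1 / 4) = Real.log 3 - 2 * Real.log 2 := by
    rw [show (1 - 1 / 4 : ℝ) = 3 / 2 ^ 2 by norm_num, Real.log_div (by norm_num) (by norm_num),
      Real.log_pow]
    push_cast; ring
  have e2 : Real.log (1 - 1 / 9) = 3 * Real.log 2 - 2 * Real.log 3 := by
    rw [show (1 - 1 / 9 : ℝ) = 2 ^ 3 / 3 ^ 2 by norm_num, Real.log_div (by norm_num) (by norm_num),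
      Real.log_pow, Real.log_pow]
    push_cast; ring
  rw [e1] at h1
  rw [e2] at h2
  simp only [Finset.sum_range_succ, Finset.sum_range_zero] at h1 h2
  norm_num at h1 h2
  rw [abs_le] at h1 h2
  norm_num at h1 h2
  constructor <;> rw [abs_le] <;> norm_num <;> constructor <;> linarith [h1.1, h1.2, h2.1, h2.2]

lemma evZ_vals : evZ GG 2 = 64359558652859423755366878792710078194119719018466101092140606822954125073848394002485947187200 ∧
    evZ GG 4 = 102688217325662798402830088390917277086119569636545709967644118860526038688489023772087218995200 ∧
    evZ SS 2 = 69211349119417026640522365679617639733529060849047248483267912278002738594337275203730819215360 ∧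
    evZ SS 4 = 126277892911077353897441352108116076143633459589362720177531882997537670211338623667235301359616 := by
  decide +kernel

lemma cst_bounds :
    |3 / (8 * (DD : ℝ) * MM) * ev GG 4 - 2.6791497767315982581964323| ≤ 1 / 10 ^ 22 ∧
    |3 / (8 * (DD : ℝ) * MM) * ev GG 2 - 1.6791497767315982581964949| ≤ 1 / 10 ^ 22 ∧
    |3 / (8 * (DD : ℝ) * MM) * (ev SS 4 - ev SS 2) - 1.4888740114496277936133339| ≤ 1 / 10 ^ 22 := by
  obtain ⟨h1, h2, h3, h4⟩ := evZ_vals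
  have g2 : ev GG 2 = (evZ GG 2 : ℝ) := by exact_mod_cast ev_intCast GG 2
  have g4 : ev GG 4 = (evZ GG 4 : ℝ) := by exact_mod_cast ev_intCast GG 4
  have s2 : ev SS 2 = (evZ SS 2 : ℝ) := by exact_mod_cast ev_intCast SS 2
  have s4 : ev SS 4 = (evZ SS 4 : ℝ) := by exact_mod_cast ev_intCast SS 4
  rw [g2, g4, s2, s4, h1, h2, h3, h4]
  unfold DD MM
  push_cast
  refine ⟨?_, ?_, ?_⟩ <;> rw [abs_le] <;> constructor <;> norm_num

lemma prod_close {a a0 g g0 : ℝ} (ha : |a - a0| ≤ 1 / 10 ^ 20) (hg : |g - g0| ≤ 1 / 10 ^ 22)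
    (ha0 : |a0| ≤ 3) (hg0 : |g0| ≤ 3) : |a * g - a0 * g0| ≤ 4 / 10 ^ 20 := by
  have e : a * g - a0 * g0 = (a - a0) * (g - g0) + ((a - a0) * g0 + a0 * (g - g0)) := by ring
  rw [e]
  refine (abs_add_le _ _).trans ?_
  have h0 := abs_add_le ((a - a0) * g0) (a0 * (g - g0))
  have h1 : |(a - a0) * (g - g0)| ≤ 1 / 10 ^ 20 * (1 / 10 ^ 22) := by
    rw [abs_mul]; exact mul_le_mul ha hg (abs_nonneg _) (by norm_num)
  have h2 : |(a - a0) * g0| ≤ 1 / 10 ^ 20 * 3 := by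
    rw [abs_mul]; exact mul_le_mul ha hg0 (abs_nonneg _) (by norm_num)
  have h3 : |a0 * (g - g0)| ≤ 3 * (1 / 10 ^ 22) := by
    rw [abs_mul]; exact mul_le_mul ha0 hg (abs_nonneg _) (by norm_num)
  linarith

lemma J_close : |(∫ x, Real.log (3 * (x + 1) ^ 2) * ht x ∂nu) - 1.8349544938474827047| ≤
    1 / 10 ^ 18 := by
  rw [int_log_ht]
  obtain ⟨ha, hb⟩ := log_bounds
  obtain ⟨h4, h2, hs⟩ := cst_bounds
  have p1 := abs_le.1 (prod_close hb h4 (by rw [abs_le]; norm_num) (by rw [abs_le]; norm_num))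
  have p2 := abs_le.1 (prod_close hb h2 (by rw [abs_le]; norm_num) (by rw [abs_le]; norm_num))
  have p3 := abs_le.1 (prod_close ha h4 (by rw [abs_le]; norm_num) (by rw [abs_le]; norm_num))
  have hs' := abs_le.1 hs
  have e : 3 / (8 * (DD : ℝ) * MM) * ((Real.log 3 - 2 * Real.log 2) * (ev GG 4 - ev GG 2) +
      2 * (ev GG 4 * (2 * Real.log 2) - ev GG 2 * Real.log 2 - (ev SS 4 - ev SS 2))) =
      Real.log 3 * (3 / (8 * (DD : ℝ) * MM) * ev GG 4) -
      Real.log 3 * (3 / (8 * (DD : ℝ) * MM) * ev GG 2) +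
      2 * (Real.log 2 * (3 / (8 * (DD : ℝ) * MM) * ev GG 4)) -
      2 * (3 / (8 * (DD : ℝ) * MM) * (ev SS 4 - ev SS 2)) := by ring
  rw [e, abs_le]
  generalize Real.log 3 * (3 / (8 * (DD : ℝ) * MM) * ev GG 4) = A at *
  generalize Real.log 3 * (3 / (8 * (DD : ℝ) * MM) * ev GG 2) = B at *
  generalize Real.log 2 * (3 / (8 * (DD : ℝ) * MM) * ev GG 4) = C at *
  generalize 3 / (8 * (DD : ℝ) * MM) * (ev SS 4 - ev SS 2) = S at *
  clear e ha hb h4 h2 hs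
  norm_num at p1 p2 p3 hs' ⊢
  constructor <;> linarith [p1.1, p1.2, p2.1, p2.2, p3.1, p3.2, hs'.1, hs'.2]

lemma c0_close : |(∫ x, ht x ∂nu) - 1| ≤ 1 / 10 ^ 20 := by
  rw [int_ht]
  obtain ⟨h4, h2, -⟩ := cst_bounds
  have h4' := abs_le.1 h4
  have h2' := abs_le.1 h2
  rw [mul_sub, abs_le]
  norm_num at h4' h2' ⊢
  constructor <;> linarith [h4'.1, h4'.2, h2'.1, h2'.2]

noncomputable def phi : ℝ → ℝ :=
  (Set.Ico (0 : ℝ) 1).indicator fun x => Real.log (3 * (x + 1) ^ 2)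

lemma phi_measurable : Measurable phi := by
  apply Measurable.indicator _ measurableSet_Ico
  fun_prop

lemma phi_bound (x : ℝ) : |phi x| ≤ 5 / 2 := by
  unfold phi
  by_cases hx : x ∈ Set.Ico (0 : ℝ) 1
  · rw [Set.indicator_of_mem hx]
    have h3 : 3 ≤ 3 * (x + 1) ^ 2 := by nlinarith [hx.1]
    have h12 : 3 * (x + 1) ^ 2 ≤ 12 := by nlinarith [hx.1, hx.2]
    have hl : 0 ≤ Real.log (3 * (x + 1) ^ 2) := Real.log_nonneg (by linarith)
    rw [abs_of_nonneg hl]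
    refine (Real.log_le_log (by linarith) h12).trans ?_
    have e : Real.log 12 = 2 * Real.log 2 + Real.log 3 := by
      rw [show (12 : ℝ) = 2 ^ 2 * 3 by norm_num, Real.log_mul (by norm_num) (by norm_num),
        Real.log_pow]
      push_cast; ring
    rw [e]
    obtain ⟨ha, hb⟩ := log_bounds
    have ha' := (abs_le.1 ha).2
    have hb' := (abs_le.1 hb).2
    norm_num at ha' hb'
    linarith
  · rw [Set.indicator_of_notMem hx]
    norm_num

end BR

theorem entropy_estimate_T3 (μ : Measure ℝ) [IsProbabilityMeasure μ]
    (hsupp : μ (Set.Ico (0 : ℝ) 1)ᶜ = 0)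
    (hinv : ∀ A : Set ℝ, MeasurableSet A → μ (T3 ⁻¹' A) = μ A)
    (hac : μ ≪ volume) :
    |(∫ x, Real.log (3 * (x + 1) ^ 2) ∂μ) - 1.834954493847482| ≤ 1e-15 := by
  have hae : ∀ᵐ x ∂μ, x ∈ Set.Ico (0 : ℝ) 1 := by
    rw [ae_iff]; exact hsupp
  have hI : ∫ x, Real.log (3 * (x + 1) ^ 2) ∂μ = ∫ x, BR.phi x ∂μ := by
    apply integral_congr_ae
    filter_upwards [hae] with x hx
    unfold BR.phi
    rw [Set.indicator_of_mem hx]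
  have hJ : ∫ x, BR.phi x * BR.ht x ∂BR.nu =
      ∫ x, Real.log (3 * (x + 1) ^ 2) * BR.ht x ∂BR.nu := by
    apply integral_congr_ae
    filter_upwards [BR.ae_nu] with x hx
    unfold BR.phi
    rw [Set.indicator_of_mem hx]
  obtain ⟨K, hK, hL⟩ := BR.ht_lip
  have hst := BR.stability μ hsupp hinv hac BR.phi_measurable BR.phi_bound hK hL (by norm_num)
    BR.err_lip
  rw [hJ] at hst
  rw [hI]
  have hb : |∫ x, BR.phi x ∂μ| ≤ 5 / 2 := by
    have := norm_integral_le_of_norm_le_const (μ := μ) (f := BR.phi) (C := 5 / 2)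
      (Eventually.of_forall fun x => BR.phi_bound x)
    simpa using this
  have hc := BR.c0_close
  have hj := abs_le.1 BR.J_close
  have hst' := abs_le.1 hst
  have hd : |((∫ x, BR.ht x ∂BR.nu) - 1) * ∫ x, BR.phi x ∂μ| ≤ 1 / 10 ^ 20 * (5 / 2) := by
    rw [abs_mul]
    exact mul_le_mul hc hb (abs_nonneg _) (by norm_num)
  have hd' := abs_le.1 hd
  rw [sub_mul, one_mul] at hd'
  generalize (∫ x, BR.ht x ∂BR.nu) * ∫ x, BR.phi x ∂μ = P at *
  generalize ∫ x, BR.phi x ∂μ = I at *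
  generalize ∫ x, Real.log (3 * (x + 1) ^ 2) * BR.ht x ∂BR.nu = J at *
  rw [abs_le]
  norm_num at hd' hst' hj ⊢
  constructor <;> linarith [hd'.1, hd'.2, hst'.1, hst'.2, hj.1, hj.2]
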